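/- arXiv:1302.5728 — 5 statements merged into one kernel-verified Lean document; each statement's English description precedes it below -/
import Mathlib

section
/- Let k be a cubic field and let p be a prime ideal of Z_k dividing 2*Z_k that is unramified over 2, and set c = 2*Z_k / p. Then there exists beta in k^* of square norm, with v_q(beta) = 0 for every prime ideal q dividing c, such that beta ≡ -1 (mod^* c^2); consequently z_k(c) = [Z_c : Z_c[N]] = 1, i.e., every class in (Z_k/c^2)^* has a lift whose norm to QQ is a square. -/
set_option maxHeartbeats 1000000
set_option synthInstance.maxHeartbeats 400000

open NumberField

/-- The subgroup `Z_c[N] ≤ Z_c = (𝓞 k / c²)ˣ` of classes having a lift to `𝓞 k`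
whose norm down to `ℚ` is a square.  The index `z_k(c) = [Z_c : Z_c[N]]` is
`(squareNormLift c).index`; in particular `z_k(c) = 1` iff every class in
`(𝓞 k / c²)ˣ` has a lift of square norm. -/
noncomputable def squareNormLift {k : Type*} [Field k] [NumberField k]
    (c : Ideal (𝓞 k)) : Subgroup ((𝓞 k ⧸ c ^ 2)ˣ) where
  carrier := {u | ∃ β : 𝓞 k, Ideal.Quotient.mk (c ^ 2) β = (u : 𝓞 k ⧸ c ^ 2) ∧
      IsSquare (Algebra.norm ℚ (algebraMap (𝓞 k) k β))}
  one_mem' := ⟨1, by simp, by simp⟩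
  mul_mem' := by
    rintro u v ⟨β, hβ, sβ⟩ ⟨γ, hγ, sγ⟩
    refine ⟨β * γ, ?_, ?_⟩
    · rw [map_mul, hβ, hγ, Units.val_mul]
    · rw [map_mul, map_mul]
      exact sβ.mul sγ
  inv_mem' := by
    rintro u ⟨β, hβ, sβ⟩
    obtain ⟨γ, hγ⟩ := Ideal.Quotient.mk_surjective ((u⁻¹ : (𝓞 k ⧸ c ^ 2)ˣ) : 𝓞 k ⧸ c ^ 2)
    refine ⟨β * γ ^ 2, ?_, ?_⟩
    · rw [map_mul, map_pow, hβ, hγ, ← Units.val_pow_eq_pow_val, ← Units.val_mul]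
      congr 1
      group
    · rw [map_mul, map_mul, map_pow, map_pow]
      exact sβ.mul ⟨Algebra.norm ℚ (algebraMap (𝓞 k) k γ), (sq _)⟩

/-- There is an element of `c` of odd trace. -/
theorem exists_trace_odd {k : Type*} [Field k] [NumberField k]
    (P Q : Ideal (𝓞 k)) [P.IsMaximal] (hPQ : IsCoprime P Q)
    (hP' : P * Q = Ideal.span {(2 : 𝓞 k)}) :
    ∃ x ∈ Q, Odd (Algebra.trace ℤ (𝓞 k) x) := by
  let p : Ideal ℤ := Ideal.span {(2 : ℤ)}
  have hpm : p.IsMaximal :=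
    PrincipalIdealRing.isMaximal_of_irreducible Int.prime_two.irreducible
  have hP : P * Q = Ideal.map (algebraMap ℤ (𝓞 k)) p := by
    rw [hP', Ideal.map_span]; simp
  have hfin : Finite (ℤ ⧸ p) := by
    have := Ideal.finiteQuotientOfFreeOfNeBot p (by simp [p])
    exact this
  have hlo : P.LiesOver p := by
    constructor
    refine hpm.eq_of_le ?_ ?_
    · simpa using ‹P.IsMaximal›.ne_top
    · rw [← Ideal.map_le_iff_le_comap, ← hP]
      exact Ideal.mul_le_left
  let := Ideal.Quotient.field p
  let := Ideal.Quotient.field P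
  let : Algebra (ℤ ⧸ p) (𝓞 k ⧸ Q) := Ideal.Quotient.algebraQuotientOfLEComap (by
      rw [← Ideal.map_le_iff_le_comap, ← hP]
      exact Ideal.mul_le_right)
  have : IsScalarTower ℤ (ℤ ⧸ p) (𝓞 k ⧸ Q) := .of_algebraMap_eq' rfl
  have : Module.Finite (ℤ ⧸ p) (𝓞 k ⧸ Q) :=
    Module.Finite.of_restrictScalars_finite ℤ (ℤ ⧸ p) (𝓞 k ⧸ Q)
  let e : (𝓞 k ⧸ p.map (algebraMap ℤ (𝓞 k))) ≃ₐ[ℤ ⧸ p] ((𝓞 k ⧸ P) × 𝓞 k ⧸ Q) :=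
    { __ := (Ideal.quotEquivOfEq hP.symm).trans (Ideal.quotientMulEquivQuotientProd P Q hPQ),
      commutes' := Quotient.ind fun _ ↦ rfl }
  obtain ⟨x, hx⟩ : ∃ x, Algebra.trace (ℤ ⧸ p) (𝓞 k ⧸ P) x ≠ 0 := by
    simpa [LinearMap.ext_iff] using Algebra.trace_ne_zero (ℤ ⧸ p) (𝓞 k ⧸ P)
  obtain ⟨y, hy⟩ := Ideal.Quotient.mk_surjective (e.symm (x, 0))
  refine ⟨y, ?_, ?_⟩
  · have := congrArg (fun t => (e t).2) hy
    simp at this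
    simpa [e, Ideal.Quotient.eq_zero_iff_mem] using this
  · have h : Algebra.intTrace ℤ (𝓞 k) y ∉ p := by
      rw [← Ideal.Quotient.eq_zero_iff_mem, ← Algebra.trace_quotient_eq_of_isDedekindDomain,
        hy, Algebra.trace_eq_of_algEquiv, Algebra.trace_prod_apply]
      simpa
    rw [Algebra.intTrace_eq_trace, Ideal.mem_span_singleton, ← even_iff_two_dvd] at h
    exact Int.not_even_iff_odd.mp h

theorem lift_of_norm {k : Type*} [Field k] [NumberField k]
    (hfr : Module.finrank ℤ (𝓞 k) = 3) (c : Ideal (𝓞 k)) (h2c : (2 : 𝓞 k) ∈ c) (a : 𝓞 k) :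
    ∀ α : 𝓞 k, α - a ∈ c ^ 2 → (4 : ℤ) ∣ Algebra.norm ℤ α - 1 →
      ∃ β : 𝓞 k, β - a ∈ c ^ 2 ∧ IsSquare (Algebra.norm ℚ (algebraMap (𝓞 k) k β)) := by
  intro α hα hN
  refine ⟨α * algebraMap ℤ (𝓞 k) (Algebra.norm ℤ α), ?_, ?_⟩
  · obtain ⟨m, hm⟩ := hN
    have : α * algebraMap ℤ (𝓞 k) (Algebra.norm ℤ α) - a
        = (α - a) + 2 ^ 2 * (α * algebraMap ℤ (𝓞 k) m) := by
      rw [show Algebra.norm ℤ α = 1 + 4 * m by omega]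
      push_cast [map_add, map_mul, map_one]
      simp
      ring
    rw [this]
    exact Ideal.add_mem _ hα (Ideal.mul_mem_right _ _ (Ideal.pow_mem_pow h2c 2))
  · have h := Algebra.coe_norm_int (α * algebraMap ℤ (𝓞 k) (Algebra.norm ℤ α))
    change IsSquare (Algebra.norm ℚ ((α * algebraMap ℤ (𝓞 k) (Algebra.norm ℤ α) : 𝓞 k) : k))
    rw [← h, map_mul, Algebra.norm_algebraMap, hfr]
    exact ⟨((Algebra.norm ℤ α) ^ 2 : ℤ), by push_cast; ring⟩

theorem odd_norm_lift {k : Type*} [Field k] [NumberField k] (p c : Ideal (𝓞 k))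
    (hpc : p * c = Ideal.span {(2 : 𝓞 k)}) (a b α : 𝓞 k) (hab : a * b - 1 ∈ c ^ 2)
    (hαc : α - a ∈ c ^ 2) (hαp : α - 1 ∈ p) : Odd (Algebra.norm ℤ α) := by
  have h1 : α * b - 1 ∈ c := by
    have : α * b - 1 = (α - a) * b + (a * b - 1) := by ring
    rw [this]
    exact Ideal.pow_le_self two_ne_zero (Ideal.add_mem _ (Ideal.mul_mem_right _ _ hαc) hab)
  have h4 : (α - 1) * (α * b - 1) ∈ Ideal.span {(2 : 𝓞 k)} := hpc ▸ Ideal.mul_mem_mul hαp h1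
  obtain ⟨z, hz⟩ := Ideal.mem_span_singleton.mp h4
  have h5 : α * (1 + b - α * b) = 1 + (2 : ℤ) • (-z) := by
    rw [zsmul_eq_mul]; push_cast; linear_combination -hz
  obtain ⟨r, hr⟩ := Algebra.norm_one_add_smul (2 : ℤ) (-z)
  rw [← h5, map_mul] at hr
  refine Int.Odd.of_mul_left (n := Algebra.norm ℤ (1 + b - α * b)) ?_
  rw [hr]
  exact ⟨Algebra.trace ℤ (𝓞 k) (-z) + r * 2, by ring⟩

theorem exists_crt {R : Type*} [CommRing R] (p c : Ideal R)
    (hcop : IsCoprime p c) (a : R) :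
    ∃ α : R, α - a ∈ c ^ 2 ∧ α - 1 ∈ p := by
  have h := IsCoprime.pow_right (n := 2) hcop
  obtain ⟨u, hu, v, hv, huv⟩ := Ideal.isCoprime_iff_exists.mp h
  refine ⟨a * u + v, ?_, ?_⟩
  · rw [show a * u + v - a = v * (1 - a) by rw [← eq_sub_iff_add_eq] at huv; rw [huv]; ring]
    exact Ideal.mul_mem_right _ _ hv
  · rw [show a * u + v - 1 = u * (a - 1) by rw [← eq_sub_iff_add_eq'] at huv; rw [huv]; ring]
    exact Ideal.mul_mem_right _ _ hu

theorem coprime_of_unram {R : Type*} [CommRing R] [IsDedekindDomain R] (p c I : Ideal R)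
    (hpm : p.IsMaximal) (hpc : p * c = I) (hunram : ¬ p ^ 2 ∣ I) : IsCoprime p c := by
  rw [Ideal.isCoprime_iff_sup_eq]
  by_contra hne
  have hle : c ≤ p := by
    have := hpm.eq_of_le hne le_sup_left
    rw [this]; exact le_sup_right
  obtain ⟨d, hd⟩ := Ideal.dvd_iff_le.mpr hle
  refine hunram (Dvd.intro d ?_)
  rw [← hpc, hd, sq, mul_assoc]

theorem mem_right_of_mem_mul {R : Type*} [CommRing R] (p c : Ideal R) (x : R)
    (h : x ∈ p * c) : x ∈ c := by
  have hle : p * c ≤ c := Ideal.mul_le_right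
  exact hle h

theorem four_dvd_aux (m n r : ℤ) (hm : Odd m) (hmod : ¬ (4 : ℤ) ∣ m - 1) (hn : Odd n) :
    (4 : ℤ) ∣ m * (1 + n * 2 + r * 2 ^ 2) - 1 := by
  obtain ⟨s, hs⟩ := hm
  obtain ⟨t, ht⟩ := hn
  obtain ⟨w, hw⟩ : Odd s := by
    rw [← Int.not_even_iff_odd]
    rintro ⟨w, hw⟩
    exact hmod ⟨w, by rw [hs, hw]; ring⟩
  rw [hs, ht, hw]
  exact ⟨(4 * w + 3) * (t + r) + 3 * w + 2, by ring⟩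

theorem exists_lift {k : Type*} [Field k] [NumberField k]
    (h3 : Module.finrank ℚ k = 3)
    (p c : Ideal (𝓞 k)) (hp : p.IsPrime) (hp0 : p ≠ ⊥)
    (hpc : p * c = Ideal.span {(2 : 𝓞 k)})
    (hunram : ¬ p ^ 2 ∣ Ideal.span {(2 : 𝓞 k)}) (a b : 𝓞 k) (hab : a * b - 1 ∈ c ^ 2) :
    ∃ β : 𝓞 k, β - a ∈ c ^ 2 ∧ IsSquare (Algebra.norm ℚ (algebraMap (𝓞 k) k β)) := by
  have hpm : p.IsMaximal := hp.isMaximal hp0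
  have hcop : IsCoprime p c := coprime_of_unram p c _ hpm hpc hunram
  have h2 : (2 : 𝓞 k) ∈ p * c := by rw [hpc]; exact Ideal.mem_span_singleton_self _
  have h2c : (2 : 𝓞 k) ∈ c := mem_right_of_mem_mul p c 2 h2
  have hfr : Module.finrank ℤ (𝓞 k) = 3 := by rw [RingOfIntegers.rank, h3]
  have key := lift_of_norm hfr c h2c a
  obtain ⟨α, hαc, hαp⟩ := exists_crt p c hcop a
  have hodd := odd_norm_lift p c hpc a b α hab hαc hαp
  by_cases hmod : (4 : ℤ) ∣ Algebra.norm ℤ α - 1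
  · exact key α hαc hmod
  obtain ⟨x, hxc, hx⟩ := exists_trace_odd p c hcop hpc
  obtain ⟨r, hr⟩ := Algebra.norm_one_add_smul (2 : ℤ) x
  refine key (α * (1 + (2 : ℤ) • x)) ?_ ?_
  · have : α * (1 + (2 : ℤ) • x) - a = (α - a) + (2 * x) * α := by
      rw [zsmul_eq_mul]; push_cast; ring
    rw [this, sq]
    rw [sq] at hαc
    exact Ideal.add_mem _ hαc (Ideal.mul_mem_right _ _ (Ideal.mul_mem_mul h2c hxc))
  · rw [map_mul, hr]
    exact four_dvd_aux _ _ r hodd hmod hx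

/-- Let `k` be a cubic field, `p` a prime ideal of `𝓞 k` over `2` which
is unramified over `2`, and `c = 2𝓞 k / p` (i.e. `p * c = 2 𝓞 k`).  Then there is
`β = γ/δ ∈ k*` of square norm, with `v_q(β) = 0` for all primes `q ∣ c` (the lift
`γ, δ ∈ 𝓞 k` being coprime to `c`), such that `β ≡ -1 (mod* c²)`, i.e.
`γ + δ ∈ c²`; consequently `z_k(c) = [Z_c : Z_c[N]] = 1`, that is, every class in
`(𝓞 k/c²)ˣ` has a lift whose norm to `ℚ` is a square. -/
theorem statement5 (k : Type*) [Field k] [NumberField k]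
    (h3 : Module.finrank ℚ k = 3)
    (p c : Ideal (𝓞 k)) (hp : p.IsPrime) (hp0 : p ≠ ⊥)
    (hpc : p * c = Ideal.span {(2 : 𝓞 k)})
    (hunram : ¬ p ^ 2 ∣ Ideal.span {(2 : 𝓞 k)}) :
    (∃ (β : k) (γ δ : 𝓞 k), γ ≠ 0 ∧ δ ≠ 0 ∧
      β = algebraMap (𝓞 k) k γ / algebraMap (𝓞 k) k δ ∧
      IsCoprime (Ideal.span {γ}) c ∧ IsCoprime (Ideal.span {δ}) c ∧
      IsSquare (Algebra.norm ℚ β) ∧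
      γ + δ ∈ c ^ 2) ∧
    (squareNormLift c).index = 1 := by
  constructor
  · obtain ⟨β, hβ, hsq⟩ := exists_lift h3 p c hp hp0 hpc hunram (-1) (-1) (by simp)
    have hβ' : β + 1 ∈ c ^ 2 := by simpa using hβ
    by_cases hβ0 : β = 0
    · have hcop : IsCoprime (Ideal.span {(1 : 𝓞 k)}) c := by
        rw [Ideal.isCoprime_iff_exists]
        exact ⟨1, Ideal.mem_span_singleton_self _, 0, Ideal.zero_mem _, by ring⟩
      refine ⟨1, 1, 1, one_ne_zero, one_ne_zero, by simp, hcop, hcop, by simp, ?_⟩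
      have h1 : (1 : 𝓞 k) ∈ c ^ 2 := by simpa [hβ0] using hβ'
      exact Ideal.add_mem _ h1 h1
    · refine ⟨algebraMap (𝓞 k) k β, β, 1, hβ0, one_ne_zero, by simp, ?_, ?_, hsq, hβ'⟩
      · rw [Ideal.isCoprime_iff_exists]
        exact ⟨-β, by simp, β + 1,
          Ideal.pow_le_self two_ne_zero hβ', by ring⟩
      · rw [Ideal.isCoprime_iff_exists]
        exact ⟨1, Ideal.mem_span_singleton_self _, 0, Ideal.zero_mem _, by ring⟩
  · rw [Subgroup.index_eq_one, eq_top_iff]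
    intro u _
    obtain ⟨a, ha⟩ := Ideal.Quotient.mk_surjective (u : 𝓞 k ⧸ c ^ 2)
    obtain ⟨b, hb⟩ := Ideal.Quotient.mk_surjective ((u⁻¹ : (𝓞 k ⧸ c ^ 2)ˣ) : 𝓞 k ⧸ c ^ 2)
    obtain ⟨β, hβ, hsq⟩ := exists_lift h3 p c hp hp0 hpc hunram a b (by
      rw [← Ideal.Quotient.eq_zero_iff_mem, map_sub, map_mul, ha, hb]; simp)
    exact ⟨β, by rw [← ha]; exact Ideal.Quotient.eq.mpr hβ, hsq⟩
end

section
/- Let k be a cubic field and let alpha be an element of k such that alpha/2 lies in Z_k and such that Tr_{k/QQ}(alpha * x) is divisible by 4 for every x in Z_k (i.e., alpha/4 lies in the codifferent of k). Then the characteristic polynomial of alpha over QQ is congruent to X^3 modulo 4 (that is, writing it as X^3 - t*X^2 + s*X - n, all of t, s, n are divisible by 4), and consequently N_{k/QQ}(alpha - 1) ≡ -1 (mod 4), so N_{k/QQ}(alpha - 1) is not a square in QQ. -/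
open NumberField Polynomial

/-- Let `k` be a cubic field and `α ∈ k` with `α/2 ∈ 𝓞 k` and
`α/4` in the codifferent of `k` (i.e. `Tr_{k/ℚ}(α x) ∈ 4ℤ` for all `x ∈ 𝓞 k`).
Then the characteristic polynomial `X³ - tX² + sX - n` of `α` over `ℚ` is congruent
to `X³` mod `4` (all of `t`, `s`, `n` lie in `4ℤ`), and consequently
`N_{k/ℚ}(α - 1) ≡ -1 (mod 4)`, so `N_{k/ℚ}(α - 1)` is not a square in `ℚ`. -/
theorem statement6 (k : Type*) [Field k] [NumberField k]
    (h3 : Module.finrank ℚ k = 3) (α : k)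
    (hhalf : IsIntegral ℤ (α / 2))
    (hcodiff : ∀ x : k, IsIntegral ℤ x → ∃ m : ℤ, Algebra.trace ℚ k (α * x) = 4 * m) :
    (∃ t s n : ℤ,
      (LinearMap.mulLeft ℚ α).charpoly =
        X ^ 3 - C ((4 * t : ℤ) : ℚ) * X ^ 2 + C ((4 * s : ℤ) : ℚ) * X - C ((4 * n : ℤ) : ℚ)) ∧
    (∃ m : ℤ, Algebra.norm ℚ (α - 1) = 4 * m - 1) ∧
    ¬ IsSquare (Algebra.norm ℚ (α - 1)) := by
  let b₀ := RingOfIntegers.basis k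
  have hcard : Fintype.card (Module.Free.ChooseBasisIndex ℤ (𝓞 k)) = 3 := by
    rw [← Module.finrank_eq_card_chooseBasisIndex, RingOfIntegers.rank, h3]
  let b := b₀.reindex (Fintype.equivFinOfCardEq hcard)
  let c : Module.Basis (Fin 3) ℚ k :=
    b.localizationLocalization ℚ (nonZeroDivisors ℤ) k
  let β : 𝓞 k := ⟨α / 2, hhalf⟩
  have hβ : algebraMap (𝓞 k) k β = α / 2 := rfl
  obtain ⟨B, hB⟩ : ∃ B, B = Algebra.leftMulMatrix b β := ⟨_, rfl⟩
  have hM : Algebra.leftMulMatrix c α = Matrix.of (fun i j => 2 * (B i j : ℚ)) := by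
    have h1 := Algebra.map_leftMulMatrix_localization (Rₘ := ℚ) (Sₘ := k)
      (M := nonZeroDivisors ℤ) (b := b) (a := β)
    rw [hβ, ← hB] at h1
    have h2 : α = (2 : k) * (α / 2) := by ring
    rw [h2, two_mul, map_add, ← h1]
    ext i j
    simp [two_mul]
  obtain ⟨m, hm⟩ := hcodiff 1 isIntegral_one
  rw [mul_one, Algebra.trace_eq_matrix_trace c, hM] at hm
  have hm' : B 0 0 + B 1 1 + B 2 2 = 2 * m := by
    simp [Matrix.trace_fin_three] at hm
    have : (B 0 0 + B 1 1 + B 2 2 : ℚ) = 2 * m := by linarith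
    exact_mod_cast this
  have hB22 : B 2 2 = 2 * m - B 0 0 - B 1 1 := by linarith
  have hnorm : ∃ m : ℤ, Algebra.norm ℚ (α - 1) = 4 * m - 1 := by
    rw [Algebra.norm_eq_matrix_det c, map_sub, hM, map_one]
    refine ⟨m - (B 0 0 * B 1 1 - B 0 1 * B 1 0 + B 0 0 * B 2 2 - B 0 2 * B 2 0
      + B 1 1 * B 2 2 - B 1 2 * B 2 1) + 2 * B.det, ?_⟩
    rw [Matrix.det_fin_three, Matrix.det_fin_three]
    simp [hB22]
    ring
  refine ⟨?_, hnorm, ?_⟩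
  · refine ⟨m, B 0 0 * B 1 1 - B 0 1 * B 1 0 + B 0 0 * B 2 2 - B 0 2 * B 2 0
      + B 1 1 * B 2 2 - B 1 2 * B 2 1, 2 * B.det, ?_⟩
    have h5 : (LinearMap.mulLeft ℚ α).charpoly = (Algebra.leftMulMatrix c α).charpoly := by
      rw [Algebra.leftMulMatrix_apply, ← LinearMap.charpoly_toMatrix _ c]
      rfl
    rw [h5, hM, Matrix.charpoly, Matrix.det_fin_three, Matrix.det_fin_three]
    simp [Matrix.charmatrix_apply, hB22]
    rw [show (C 4 : ℚ[X]) = 4 from rfl, show (C 2 : ℚ[X]) = 2 from rfl]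
    ring
  · obtain ⟨m, hm⟩ := hnorm
    rw [hm]
    rintro ⟨r, hr⟩
    have h6 : IsSquare (4 * m - 1 : ℤ) := by
      rw [← Rat.isSquare_intCast_iff]
      exact ⟨r, by push_cast; exact hr⟩
    obtain ⟨z, hz⟩ := h6
    have := congrArg (fun x : ℤ => (x : ZMod 4)) hz
    push_cast at this
    rw [show (4 : ZMod 4) = 0 from rfl] at this
    generalize (z : ZMod 4) = w at this
    revert w
    simp only [zero_mul]
    decide
end

section
/- Let k be a cubic field and let c be a nonzero ideal of Z_k dividing 2*Z_k. Then z_k(c) = 2 if and only if one of the following holds: (i) c = 2*Z_k; (ii) 2*Z_k = p1^2 * p2 with p1, p2 distinct primes of residue degree 1 and c = p1*p2; (iii) 2*Z_k = p1^2 * p2 with p1, p2 distinct primes of residue degree 1, c = p2, and Disc(k) ≡ 4 (mod 8); (iv) 2*Z_k = p1^3 and c = p1^2. In all other cases z_k(c) = 1. -/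
set_option maxHeartbeats 1000000
set_option synthInstance.maxHeartbeats 400000

open NumberField

section Part1
variable {k : Type*} [Field k] [NumberField k]

lemma aux_norm_isSquare (β : 𝓞 k) :
    IsSquare (Algebra.norm ℚ (algebraMap (𝓞 k) k β)) ↔ IsSquare (Algebra.norm ℤ β) := by
  rw [← Rat.isSquare_intCast_iff, Algebra.coe_norm_int]

lemma aux_finrank (h3 : Module.finrank ℚ k = 3) : Module.finrank ℤ (𝓞 k) = 3 := by
  rw [RingOfIntegers.rank, h3]

lemma aux_norm_int (h3 : Module.finrank ℚ k = 3) (n : ℤ) :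
    Algebra.norm ℤ (n : 𝓞 k) = n ^ 3 := by
  have := Algebra.norm_algebraMap (R := ℤ) (S := 𝓞 k) n
  rw [aux_finrank h3] at this
  simpa using this

lemma aux_four_mem {c : Ideal (𝓞 k)} (hc : c ∣ Ideal.span {(2 : 𝓞 k)}) : (4 : 𝓞 k) ∈ c ^ 2 := by
  have h2 : (2 : 𝓞 k) ∈ c := Ideal.dvd_iff_le.mp hc (Ideal.mem_span_singleton_self _)
  have := Ideal.pow_mem_pow h2 2
  norm_num at this
  exact this

lemma aux_int_mem {c : Ideal (𝓞 k)} (hc : c ∣ Ideal.span {(2 : 𝓞 k)}) {n : ℤ} (hn : n % 4 = 1) :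
    (n : 𝓞 k) - 1 ∈ c ^ 2 := by
  have : (n : 𝓞 k) - 1 = ((n / 4 : ℤ) : 𝓞 k) * 4 := by
    have h : n - 1 = n / 4 * 4 := by omega
    exact_mod_cast congrArg (Int.cast : ℤ → 𝓞 k) h
  rw [this]
  exact Ideal.mul_mem_left _ _ (aux_four_mem hc)

/-- units lift along quotients of finite rings -/
lemma aux_unit_lift {R S : Type*} [CommRing R] [CommRing S] [Finite R] (f : R →+* S)
    (r : R) (hr : IsUnit (f r)) : ∃ r' : R, IsUnit r' ∧ f r' = f r := by
  obtain ⟨i, j, hij, h⟩ := Finite.exists_ne_map_eq_of_infinite (fun n : ℕ => r ^ n)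
  wlog hlt : i < j generalizing i j
  · exact this j i hij.symm h.symm (by omega)
  obtain ⟨d, rfl⟩ := Nat.exists_eq_add_of_lt hlt
  set D := d + 1
  change r ^ i = r ^ (i + d + 1) at h
  have key : ∀ m n, i ≤ m → r ^ (m + n * D) = r ^ m := by
    intro m n hm
    induction n with
    | zero => simp
    | succ n ih =>
      obtain ⟨t, rfl⟩ := Nat.exists_eq_add_of_le hm
      have e : i + t + (n + 1) * D = (i + d + 1) + (t + n * D) := by simp [D]; ring
      rw [e, pow_add, ← h, ← pow_add, ← add_assoc, ih]
  let N := (i + 1) * D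
  have hN : r ^ (N + N) = r ^ N := key N (i + 1) (by
    show i ≤ (i+1) * (d+1); nlinarith)
  have hN1 : N = (N - 1) + 1 := by
    have : 0 < N := by positivity
    omega
  set e := r ^ N with he
  have hee : e * e = e := by rw [he, ← pow_add, hN]
  have hre : r * r ^ (N - 1) = e := by rw [he, hN1, ← pow_succ']; simp
  have hfe : f e = 1 := by
    have hu : IsUnit (f e) := by rw [he, map_pow]; exact hr.pow _
    have : f e * f e = f e * 1 := by rw [← map_mul, hee, mul_one]
    exact hu.mul_left_cancel this
  refine ⟨r * e + (1 - e), ?_, ?_⟩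
  · refine IsUnit.of_mul_eq_one (r ^ (N-1) * e + (1 - e)) ?_
    linear_combination (e * e) * hre + (e + 2 - r - r ^ (N-1)) * hee
  · simp [hfe]

instance aux_fin (n : ℕ) [NeZero n] : Finite (𝓞 k ⧸ Ideal.span {(n : 𝓞 k)}) := by
  apply Ideal.finiteQuotientOfFreeOfNeBot
  simp [NeZero.ne n]

lemma aux_norm_one_add (γ : 𝓞 k) (n : ℤ) :
    ∃ r : ℤ, Algebra.norm ℤ (1 + n * γ) = 1 + Algebra.trace ℤ (𝓞 k) γ * n + r * n ^ 2 := by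
  simpa [Algebra.smul_def] using Algebra.norm_one_add_smul n γ

lemma aux_odd_lift {c : Ideal (𝓞 k)} (hc : c ∣ Ideal.span {(2 : 𝓞 k)}) (u : (𝓞 k ⧸ c ^ 2)ˣ) :
    ∃ β : 𝓞 k, Ideal.Quotient.mk (c ^ 2) β = u ∧ Odd (Algebra.norm ℤ β) := by
  obtain ⟨β₀, hβ₀⟩ := Ideal.Quotient.mk_surjective (u : 𝓞 k ⧸ c ^ 2)
  have hle : Ideal.span {((4 : ℕ) : 𝓞 k)} ≤ c ^ 2 := by
    rw [Ideal.span_singleton_le_iff_mem]; exact_mod_cast aux_four_mem hc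
  let f := Ideal.Quotient.factor hle
  obtain ⟨r, hr, hfr⟩ := aux_unit_lift f (Ideal.Quotient.mk _ β₀) (by
    simp only [f, Ideal.Quotient.factor_mk, hβ₀]; exact u.isUnit)
  obtain ⟨β, rfl⟩ := Ideal.Quotient.mk_surjective r
  simp only [f, Ideal.Quotient.factor_mk, hβ₀] at hfr
  refine ⟨β, hfr, ?_⟩
  obtain ⟨s, hs⟩ := hr.exists_right_inv
  obtain ⟨γ, rfl⟩ := Ideal.Quotient.mk_surjective s
  rw [← map_mul, ← map_one (Ideal.Quotient.mk _), Ideal.Quotient.eq, Ideal.mem_span_singleton] at hs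
  obtain ⟨δ, hδ⟩ := hs
  obtain ⟨r, hr⟩ := aux_norm_one_add δ 4
  have h1 : β * γ = 1 + ((4 : ℤ) : 𝓞 k) * δ := by
    push_cast at hδ ⊢
    linear_combination hδ
  rw [← h1, map_mul] at hr
  have : Odd (Algebra.norm ℤ β * Algebra.norm ℤ γ) := by
    rw [hr, Int.odd_iff]; omega
  exact (Int.odd_mul.mp this).1

lemma aux_mem_of (h3 : Module.finrank ℚ k = 3) {c : Ideal (𝓞 k)}
    (hc : c ∣ Ideal.span {(2 : 𝓞 k)}) (u : (𝓞 k ⧸ c ^ 2)ˣ) (β : 𝓞 k)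
    (hβ : Ideal.Quotient.mk (c ^ 2) β = u) (hn : Algebra.norm ℤ β % 4 = 1) :
    u ∈ squareNormLift c := by
  refine ⟨β * (Algebra.norm ℤ β : ℤ), ?_, ?_⟩
  · have : Ideal.Quotient.mk (c ^ 2) ((Algebra.norm ℤ β : ℤ) : 𝓞 k) = 1 := by
      rw [← map_one (Ideal.Quotient.mk _), Ideal.Quotient.eq]
      exact aux_int_mem hc hn
    rw [map_mul, this, mul_one, hβ]
  · rw [aux_norm_isSquare, map_mul, aux_norm_int h3]
    exact ⟨Algebra.norm ℤ β ^ 2, by ring⟩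

lemma aux_norm_neg (h3 : Module.finrank ℚ k = 3) (β : 𝓞 k) :
    Algebra.norm ℤ (-β) = - Algebra.norm ℤ β := by
  have := aux_norm_int h3 (-1)
  have h : -β = ((-1 : ℤ) : 𝓞 k) * β := by push_cast; ring
  rw [h, map_mul, this]; ring

lemma aux_neg_mem (h3 : Module.finrank ℚ k = 3) {c : Ideal (𝓞 k)}
    (hc : c ∣ Ideal.span {(2 : 𝓞 k)}) (u : (𝓞 k ⧸ c ^ 2)ˣ) :
    u ∈ squareNormLift c ∨ -u ∈ squareNormLift c := by
  obtain ⟨β, hβ, ho⟩ := aux_odd_lift hc u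
  rw [Int.odd_iff] at ho
  have : Algebra.norm ℤ β % 4 = 1 ∨ Algebra.norm ℤ β % 4 = 3 := by omega
  rcases this with h | h
  · exact .inl (aux_mem_of h3 hc u β hβ h)
  · refine .inr (aux_mem_of h3 hc (-u) (-β) (by simp [hβ]) ?_)
    rw [aux_norm_neg h3]; omega

lemma aux_index_two (h3 : Module.finrank ℚ k = 3) {c : Ideal (𝓞 k)}
    (hc : c ∣ Ideal.span {(2 : 𝓞 k)})
    (h : ∀ β : 𝓞 k, β - 1 ∈ c ^ 2 → ¬ IsSquare (- Algebra.norm ℤ β)) :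
    (squareNormLift c).index = 2 := by
  have hm : (-1 : (𝓞 k ⧸ c ^ 2)ˣ) ∉ squareNormLift c := by
    rintro ⟨β, hβ, hs⟩
    rw [aux_norm_isSquare] at hs
    refine h (-β) ?_ ?_
    · rw [← Ideal.Quotient.eq, map_neg, hβ]; simp
    · rw [aux_norm_neg h3, neg_neg]; exact hs
  rw [Subgroup.index_eq_two_iff']
  refine ⟨-1, fun b => ?_⟩
  rw [neg_one_mul]
  rcases aux_neg_mem h3 hc b with hb | hb
  · refine .inr ⟨hb, fun hb' => hm ?_⟩
    have := mul_mem hb' (inv_mem hb)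
    simpa using this
  · refine .inl ⟨hb, fun hb' => hm ?_⟩
    have := mul_mem hb (inv_mem hb')
    simpa using this

lemma aux_index_one (h3 : Module.finrank ℚ k = 3) {c : Ideal (𝓞 k)}
    (hc : c ∣ Ideal.span {(2 : 𝓞 k)})
    (β : 𝓞 k) (hβ : β - 1 ∈ c ^ 2) (hn : Algebra.norm ℤ β % 4 = 3) :
    (squareNormLift c).index = 1 := by
  have hm : (-1 : (𝓞 k ⧸ c ^ 2)ˣ) ∈ squareNormLift c := by
    refine aux_mem_of h3 hc _ (-β) ?_ ?_
    · rw [map_neg, Ideal.Quotient.eq.mpr hβ]; simp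
    · rw [aux_norm_neg h3]; omega
  rw [Subgroup.index_eq_one, eq_top_iff]
  intro u _
  rcases aux_neg_mem h3 hc u with hu | hu
  · exact hu
  · simpa using mul_mem hm hu

lemma aux_index_one_trace (h3 : Module.finrank ℚ k = 3) {c : Ideal (𝓞 k)}
    (hc : c ∣ Ideal.span {(2 : 𝓞 k)})
    (γ : 𝓞 k) (hγ : 2 * γ ∈ c ^ 2) (ht : Odd (Algebra.trace ℤ (𝓞 k) γ)) :
    (squareNormLift c).index = 1 := by
  obtain ⟨r, hr⟩ := aux_norm_one_add γ 2
  refine aux_index_one h3 hc (1 + ((2 : ℤ) : 𝓞 k) * γ) (by simpa using hγ) ?_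
  rw [hr]; rw [Int.odd_iff] at ht; omega

lemma aux_index_two_trace (h3 : Module.finrank ℚ k = 3) {c : Ideal (𝓞 k)}
    (hc : c ∣ Ideal.span {(2 : 𝓞 k)}) (J : Ideal (𝓞 k))
    (hJ : c ^ 2 = Ideal.span {(2 : 𝓞 k)} * J)
    (ht : ∀ γ ∈ J, Even (Algebra.trace ℤ (𝓞 k) γ)) :
    (squareNormLift c).index = 2 := by
  refine aux_index_two h3 hc fun β hβ hs => ?_
  rw [hJ, Ideal.mem_span_singleton_mul] at hβ
  obtain ⟨γ, hγ, h⟩ := hβ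
  obtain ⟨r, hr⟩ := aux_norm_one_add γ 2
  have h1 : β = 1 + ((2 : ℤ) : 𝓞 k) * γ := by push_cast; linear_combination -h
  have h2 := ht γ hγ
  rw [← h1] at hr
  rw [Int.even_iff] at h2
  obtain ⟨s, hs⟩ := hs
  have h4 : (s * s) % 4 = 0 ∨ (s * s) % 4 = 1 := by
    rcases Int.even_or_odd' s with ⟨t, rfl | rfl⟩
    · left; ring_nf; omega
    · right; ring_nf; omega
  omega

end Part1
section Part2
variable {k : Type*} [Field k] [NumberField k]

lemma aux_map_two : Ideal.map (algebraMap ℤ (𝓞 k)) (Ideal.span {(2:ℤ)}) = Ideal.span {(2 : 𝓞 k)} := by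
  rw [Ideal.map_span]; simp

lemma aux_two_max : (Ideal.span {(2:ℤ)}).IsMaximal := by
  have : Prime (2:ℤ) := Int.prime_two
  exact PrincipalIdealRing.isMaximal_of_irreducible this.irreducible

lemma aux_trace_quot (γ : 𝓞 k) :
    haveI := aux_two_max
    Algebra.trace (ℤ ⧸ (Ideal.span {(2:ℤ)})) (𝓞 k ⧸ Ideal.map (algebraMap ℤ (𝓞 k)) (Ideal.span {(2:ℤ)}))
      (Ideal.Quotient.mk _ γ) = Ideal.Quotient.mk (Ideal.span {(2:ℤ)}) (Algebra.trace ℤ (𝓞 k) γ) := by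
  haveI := aux_two_max
  rw [Algebra.trace_quotient_eq_of_isDedekindDomain, Algebra.intTrace_eq_trace]

/-- nilpotent mod 2 implies even trace -/
lemma aux_trace_nilp (γ : 𝓞 k) (n : ℕ) (h : γ ^ n ∈ Ideal.span {(2 : 𝓞 k)}) :
    Even (Algebra.trace ℤ (𝓞 k) γ) := by
  haveI := aux_two_max
  rw [even_iff_two_dvd, ← Ideal.mem_span_singleton, ← Ideal.Quotient.eq_zero_iff_mem,
    ← aux_trace_quot, ← isNilpotent_iff_eq_zero]
  refine Algebra.isNilpotent_trace_of_isNilpotent ⟨n, ?_⟩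
  rw [← map_pow, Ideal.Quotient.eq_zero_iff_mem, aux_map_two]
  exact h

lemma aux_unram (P Q : Ideal (𝓞 k)) [P.IsMaximal] (hPQ : IsCoprime P Q)
    (h : Ideal.span {(2 : 𝓞 k)} = P * Q) : ∃ γ ∈ Q, Odd (Algebra.trace ℤ (𝓞 k) γ) := by
  haveI := aux_two_max
  set p := Ideal.span {(2:ℤ)} with hp
  have hP : P * Q = Ideal.map (algebraMap ℤ (𝓞 k)) p := by rw [hp, aux_map_two, h]
  haveI : P.LiesOver p := by
    constructor
    refine ‹p.IsMaximal›.eq_of_le ?_ ?_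
    · simpa using ‹P.IsMaximal›.ne_top
    · rw [← Ideal.map_le_iff_le_comap, ← hP]
      exact Ideal.mul_le_left
  let : Algebra (ℤ ⧸ p) (𝓞 k ⧸ Q) := Ideal.Quotient.algebraQuotientOfLEComap (by
      rw [← Ideal.map_le_iff_le_comap, ← hP]
      exact Ideal.mul_le_right)
  have : IsScalarTower ℤ (ℤ ⧸ p) (𝓞 k ⧸ Q) := .of_algebraMap_eq' rfl
  have : Module.Finite (ℤ ⧸ p) (𝓞 k ⧸ Q) :=
    Module.Finite.of_restrictScalars_finite ℤ (ℤ ⧸ p) (𝓞 k ⧸ Q)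
  let e : (𝓞 k ⧸ p.map (algebraMap ℤ (𝓞 k))) ≃ₐ[ℤ ⧸ p] ((𝓞 k ⧸ P) × 𝓞 k ⧸ Q) :=
    { __ := (Ideal.quotEquivOfEq hP.symm).trans (Ideal.quotientMulEquivQuotientProd P Q hPQ),
      commutes' := Quotient.ind fun _ ↦ rfl }
  haveI : Finite (ℤ ⧸ p) := by
    apply Ideal.finiteQuotientOfFreeOfNeBot
    simp [hp]
  letI : Field (ℤ ⧸ p) := Ideal.Quotient.field p
  letI : Field (𝓞 k ⧸ P) := Ideal.Quotient.field P
  haveI : Algebra.IsSeparable (ℤ ⧸ p) (𝓞 k ⧸ P) := inferInstance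
  obtain ⟨x, hx⟩ : ∃ x, Algebra.trace (ℤ ⧸ p) (𝓞 k ⧸ P) x ≠ 0 := by
    simpa [LinearMap.ext_iff] using Algebra.trace_ne_zero (ℤ ⧸ p) (𝓞 k ⧸ P)
  obtain ⟨y, hy⟩ := Ideal.Quotient.mk_surjective (e.symm (x, 0))
  refine ⟨y, ?_, ?_⟩
  · have := congrArg (fun z => (e z).2) hy
    simp at this
    simpa [e, Ideal.Quotient.eq_zero_iff_mem] using this
  · rw [← Int.not_even_iff_odd, even_iff_two_dvd, ← Ideal.mem_span_singleton,
      ← Ideal.Quotient.eq_zero_iff_mem, ← aux_trace_quot,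
      hy, Algebra.trace_eq_of_algEquiv, Algebra.trace_prod_apply]
    simpa

end Part2
section Part3

/-- The norm form of `ℤ[θ]`, `θ³ + aθ² + bθ + c = 0`. -/
def auxNF {R : Type*} [CommRing R] (a b c x y z : R) : R :=
  x * ((x - b * z) * (x - a * y + (a ^ 2 - b) * z) - (y - a * z) * (-b * y + (a * b - c) * z))
  - y * ((-c * z) * (x - a * y + (a ^ 2 - b) * z) - (y - a * z) * (-c * y + a * c * z))
  + z * ((-c * z) * (-b * y + (a * b - c) * z) - (x - b * z) * (-c * y + a * c * z))

lemma auxNF_cast (a b c x y z : ℤ) : ((auxNF a b c x y z : ℤ) : ZMod 4) =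
    auxNF (a : ZMod 4) b c x y z := by
  simp only [auxNF]; push_cast; ring

lemma aux_cast_mod (n m : ℤ) (h : n % 4 = m % 4) : ((n : ℤ) : ZMod 4) = ((m : ℤ) : ZMod 4) := by
  rw [ZMod.intCast_eq_intCast_iff]; exact h

lemma auxNF_mod_zero (x y z : ZMod 4) (h : x + y + z = 1) :
    auxNF 1 0 2 x y z ≠ 3 ∧ (auxNF 1 0 2 x y z = 0 → 2 * x = 0 ∧ 2 * y = 0) := by
  revert x y z; unfold auxNF; decide

lemma auxNF_mod_two : auxNF (3 : ZMod 4) 2 2 1 (-1) 1 = 3 := by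
  unfold auxNF; decide

lemma aux_two_mul_zero (x : ℤ) (h : 2 * (x : ZMod 4) = 0) : x % 2 = 0 := by
  have : ((2 * x : ℤ) : ZMod 4) = 0 := by push_cast; exact h
  rw [ZMod.intCast_zmod_eq_zero_iff_dvd] at this
  omega

lemma aux_descent (a b c : ℤ) (hc : c % 4 = 2) (hb : b % 4 = 0) (hs : (1 + a + b + c) % 8 = 0) :
    ∀ (n : ℕ) (s w x y z : ℤ), s.natAbs = n → s ≠ 0 → w % 4 = 1 → (x + y + z) % 4 = 1 →
      auxNF a b c x y z ≠ - (s ^ 2 * w) := by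
  intro n
  induction n using Nat.strong_induction_on with
  | _ n ih =>
  intro s w x y z hsn hs0 hw hxyz hN
  have e1 : ((auxNF a b c x y z : ℤ) : ZMod 4) = auxNF 1 0 2 (x : ZMod 4) y z := by
    rw [auxNF_cast, aux_cast_mod a 1 (by omega), aux_cast_mod b 0 (by omega),
      aux_cast_mod c 2 (by omega)]
    norm_num
  have e2 : (x : ZMod 4) + y + z = 1 := by
    have := aux_cast_mod (x + y + z) 1 (by omega)
    push_cast at this; exact this
  obtain ⟨h3, h0⟩ := auxNF_mod_zero x y z e2
  rw [← e1] at h3 h0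
  have hw4 : (w : ZMod 4) = 1 := by
    have := aux_cast_mod w 1 (by omega)
    simpa using this
  rw [hN] at h3 h0
  push_cast at h3 h0
  rw [hw4] at h3 h0
  rcases Int.even_or_odd' s with ⟨t, ht | ht⟩
  · obtain ⟨hx, hy⟩ := h0 (by
      rw [ht]; push_cast
      have : (2 : ZMod 4) * 2 = 0 := by decide
      linear_combination (-(t : ZMod 4) ^ 2) * this)
    have hx := aux_two_mul_zero x hx
    have hy := aux_two_mul_zero y hy
    obtain ⟨x', hx'⟩ : ∃ x', 2 * x' = x - z * c := by
      have : (x - z * c) % 2 = 0 := by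
        rw [Int.sub_emod, Int.mul_emod]
        have : c % 2 = 0 := by omega
        simp [this, hx]
      exact ⟨(x - z * c) / 2, by omega⟩
    obtain ⟨y', hy'⟩ : ∃ y', 2 * y' = x + y - z * b := by
      have : (x + y - z * b) % 2 = 0 := by
        rw [Int.sub_emod, Int.mul_emod]
        have : b % 2 = 0 := by omega
        have : (x + y) % 2 = 0 := by omega
        simp [*]
      exact ⟨(x + y - z * b) / 2, by omega⟩
    obtain ⟨a', ha'⟩ : ∃ a', a = 2 * a' + 1 := ⟨a / 2, by omega⟩
    obtain ⟨y'', hy''⟩ : ∃ y'', y = 2 * y'' := ⟨y / 2, by omega⟩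
    obtain ⟨z', hz'⟩ : ∃ z', 2 * z' = y + z - z * a := ⟨y'' - z * a', by rw [ha', hy'']; ring⟩
    obtain ⟨p, hp⟩ : ∃ p, 1 - a + b - c = 2 * p := ⟨(1 - a + b - c) / 2, by omega⟩
    have hp4 : p % 4 = 1 := by omega
    have hid : 8 * auxNF a b c x' y' z' = auxNF a b c x y z * (1 - a + b - c) := by
      have : 8 * auxNF a b c x' y' z' = auxNF a b c (2 * x') (2 * y') (2 * z') := by
        unfold auxNF; ring
      rw [this, hx', hy', hz']; unfold auxNF; ring
    have hN' : auxNF a b c x' y' z' = - (t ^ 2 * (w * p)) := by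
      rw [hN, hp, ht] at hid
      have h8 : 8 * auxNF a b c x' y' z' = 8 * (- (t ^ 2 * (w * p))) := by linear_combination hid
      omega
    refine ih t.natAbs (by omega) t (w * p) x' y' z' rfl (by omega) ?_ ?_ hN'
    · rw [Int.mul_emod, hw, hp4]; norm_num
    · obtain ⟨q, hq⟩ : ∃ q, 1 + a + b + c = 8 * q := ⟨(1 + a + b + c) / 8, by omega⟩
      have : 2 * (x' + y' + z') = 2 * (x + y + z - 4 * (z * q)) := by
        linear_combination hx' + hy' + hz' - z * hq
      omega
  · apply h3
    rw [ht]; push_cast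
    have : (4 : ZMod 4) = 0 := by decide
    linear_combination (-(t : ZMod 4) ^ 2 - t - 1) * this

end Part3
section Part4
open Matrix

lemma aux_conj {O : Type*} [CommRing O] (B : Module.Basis (Fin 3) ℤ O) (v : Fin 3 → O)
    (hP : (B.toMatrix v).det ≠ 0) (β : O) (C : Matrix (Fin 3) (Fin 3) ℤ)
    (h : ∀ l, β * v l = ∑ i, C i l • v i) :
    Algebra.norm ℤ β = C.det ∧ Algebra.trace ℤ O β = C.trace := by
  set P := B.toMatrix v with hPdef
  have hLP : Algebra.leftMulMatrix B β * P = P * C := by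
    ext i l
    have h1 : (Algebra.leftMulMatrix B β * P) i l = (Algebra.leftMulMatrix B β *ᵥ (B.repr (v l))) i := by
      simp [Matrix.mul_apply, Matrix.mulVec, dotProduct, hPdef, Module.Basis.toMatrix_apply]
    rw [h1, Algebra.leftMulMatrix_mulVec_repr, h l]
    simp only [Matrix.mul_apply, hPdef, Module.Basis.toMatrix_apply, map_sum, map_smul,
      Finsupp.finsetSum_apply, Finsupp.smul_apply, smul_eq_mul]
    exact Finset.sum_congr rfl fun _ _ => mul_comm _ _
  constructor
  · rw [Algebra.norm_eq_matrix_det B]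
    have := congrArg Matrix.det hLP
    rw [Matrix.det_mul, Matrix.det_mul, mul_comm P.det] at this
    exact mul_right_cancel₀ hP this
  · rw [Algebra.trace_eq_matrix_trace B]
    have h2 : (Algebra.leftMulMatrix B β * P * P.adjugate).trace = (P * C * P.adjugate).trace := by
      rw [hLP]
    rw [Matrix.mul_assoc, Matrix.mul_adjugate, Matrix.trace_mul_comm (P * C), ← Matrix.mul_assoc,
      Matrix.adjugate_mul] at h2
    rw [Matrix.mul_smul, Matrix.smul_mul, Matrix.trace_smul, Matrix.trace_smul, Matrix.mul_one,
      Matrix.one_mul] at h2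
    exact mul_left_cancel₀ hP h2

lemma aux_span {O : Type*} [CommRing O] (B : Module.Basis (Fin 3) ℤ O) (v : Fin 3 → O) (β : O) :
    ∃ w : Fin 3 → ℤ, (B.toMatrix v).det • β = ∑ i, w i • v i := by
  set P := B.toMatrix v with hPdef
  refine ⟨P.adjugate *ᵥ (B.repr β), ?_⟩
  apply B.repr.injective
  ext i
  have h1 : (P *ᵥ (P.adjugate *ᵥ (B.repr β))) i = P.det * B.repr β i := by
    rw [Matrix.mulVec_mulVec, Matrix.mul_adjugate]; simp
  simp only [map_smul, map_sum, Finsupp.smul_apply, Finsupp.finsetSum_apply, smul_eq_mul]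
  rw [← h1]
  simp only [Matrix.mulVec, dotProduct, hPdef, Module.Basis.toMatrix_apply]
  exact Finset.sum_congr rfl fun _ _ => mul_comm _ _

lemma aux_odd_det {O : Type*} [CommRing O] (B : Module.Basis (Fin 3) ℤ O) (v : Fin 3 → O)
    (h : ∀ g : Fin 3 → ℤ, (2 : O) ∣ ∑ i, g i • v i → ∀ i, 2 ∣ g i) :
    Odd (B.toMatrix v).det := by
  set P := B.toMatrix v with hPdef
  by_contra hodd
  rw [Int.not_odd_iff_even, even_iff_two_dvd] at hodd
  have h0 : (P.map (Int.castRingHom (ZMod 2))).det = 0 := by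
    have := (Int.castRingHom (ZMod 2)).map_det P
    rw [RingHom.mapMatrix_apply] at this
    rw [← this]
    exact (ZMod.intCast_zmod_eq_zero_iff_dvd _ 2).mpr hodd
  obtain ⟨u, hu0, hu⟩ := Matrix.exists_mulVec_eq_zero_iff.mpr h0
  choose g hg using fun i => ZMod.intCast_surjective (u i)
  apply hu0
  have hdvd : (2 : O) ∣ ∑ i, g i • v i := by
    have h2 : ∀ i, (2:ℤ) ∣ B.repr (∑ i, g i • v i) i := by
      intro i
      have := congrFun hu i
      rw [← Nat.cast_ofNat, ← ZMod.intCast_zmod_eq_zero_iff_dvd]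
      simp only [Matrix.mulVec, dotProduct, Matrix.map_apply, hPdef, Module.Basis.toMatrix_apply,
        Pi.zero_apply] at this
      rw [← this]
      simp only [map_smul, map_sum, Finsupp.smul_apply, Finsupp.finsetSum_apply, smul_eq_mul]
      push_cast
      refine Finset.sum_congr rfl fun l _ => ?_
      rw [hg, mul_comm]; rfl
    choose q hq using h2
    refine ⟨∑ i, q i • B i, ?_⟩
    conv_lhs => rw [← B.sum_repr (∑ i, g i • v i)]
    rw [Finset.mul_sum]
    refine Finset.sum_congr rfl fun i _ => ?_
    rw [hq i, mul_smul]
    simp [zsmul_eq_mul]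
  have := h g hdvd
  ext i
  rw [← hg i]
  exact (ZMod.intCast_zmod_eq_zero_iff_dvd _ 2).mpr (this i)

lemma aux_discr {O : Type*} [CommRing O] (B : Module.Basis (Fin 3) ℤ O) (v : Fin 3 → O) :
    Algebra.discr ℤ v = (B.toMatrix v).det ^ 2 * Algebra.discr ℤ B := by
  rw [← Algebra.discr_of_matrix_vecMul]
  congr 1
  ext i
  have := B.sum_toMatrix_smul_self v i
  simp [Matrix.vecMul, dotProduct, ← this, mul_comm, zsmul_eq_mul]

lemma aux_cayley {O : Type*} [CommRing O] (B : Module.Basis (Fin 3) ℤ O) (θ : O) :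
    ∃ a b c : ℤ, θ ^ 3 + a * θ ^ 2 + b * θ + c = 0 := by
  have : Module.Finite ℤ O := Module.Finite.of_basis B
  have : Module.Free ℤ O := Module.Free.of_basis B
  set f := (Algebra.lmul ℤ O θ).charpoly with hf
  have hm : f.Monic := LinearMap.charpoly_monic _
  have hd : f.natDegree = 3 := by
    rw [hf, LinearMap.charpoly_natDegree, Module.finrank_eq_card_basis B]; simp
  have h0 : Polynomial.aeval θ f = 0 := by
    have h1 := LinearMap.aeval_self_charpoly (Algebra.lmul ℤ O θ)
    have h2 := Polynomial.aeval_algHom_apply (Algebra.lmul ℤ O) θ f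
    rw [← hf] at h1
    rw [h1] at h2
    have h3 := congrArg (fun g : Module.End ℤ O => g 1) h2
    simpa using h3.symm
  refine ⟨f.coeff 2, f.coeff 1, f.coeff 0, ?_⟩
  rw [Polynomial.aeval_eq_sum_range, hd] at h0
  have hc : f.coeff 3 = 1 := by rw [← hd]; exact hm
  simp [Finset.sum_range_succ, hc, zsmul_eq_mul] at h0
  linear_combination h0

/-- All the explicit formulas. -/
lemma aux_formulas {O : Type*} [CommRing O] (B : Module.Basis (Fin 3) ℤ O) (θ : O) (a b c : ℤ)
    (hθ : θ ^ 3 + a * θ ^ 2 + b * θ + c = 0) (hP : (B.toMatrix ![1, θ, θ ^ 2]).det ≠ 0) :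
    (∀ x y z : ℤ, Algebra.norm ℤ (x + y * θ + z * θ ^ 2 : O) = auxNF a b c x y z) ∧
    (∀ x y z : ℤ, Algebra.trace ℤ O (x + y * θ + z * θ ^ 2 : O) =
      3 * x - a * y + (a ^ 2 - 2 * b) * z) ∧
    Algebra.discr ℤ ![1, θ, θ ^ 2] = a ^ 2 * b ^ 2 - 4 * b ^ 3 - 4 * a ^ 3 * c + 18 * a * b * c
      - 27 * c ^ 2 := by
  have key : ∀ x y z : ℤ, _ := fun x y z =>
    aux_conj B ![1, θ, θ ^ 2] hP (x + y * θ + z * θ ^ 2 : O)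
    !![x, -c * z, -c * y + a * c * z; y, x - b * z, -b * y + (a * b - c) * z;
       z, y - a * z, x - a * y + (a ^ 2 - b) * z] (by
      intro l
      fin_cases l
      · simp [Fin.sum_univ_three, zsmul_eq_mul]
      · simp [Fin.sum_univ_three, zsmul_eq_mul]
        linear_combination (z : O) * hθ
      · simp [Fin.sum_univ_three, zsmul_eq_mul]
        linear_combination ((y : O) + z * θ - a * z) * hθ)
  have ht : ∀ x y z : ℤ, Algebra.trace ℤ O (x + y * θ + z * θ ^ 2 : O) =
      3 * x - a * y + (a ^ 2 - 2 * b) * z := by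
    intro x y z
    rw [(key x y z).2, Matrix.trace_fin_three]
    simp; ring
  refine ⟨fun x y z => ?_, ht, ?_⟩
  · rw [(key x y z).1, Matrix.det_fin_three]
    simp [auxNF]; ring
  · have t0 : Algebra.trace ℤ O 1 = 3 := by simpa using ht 1 0 0
    have t1 : Algebra.trace ℤ O θ = -a := by simpa using ht 0 1 0
    have t2 : Algebra.trace ℤ O (θ ^ 2) = a ^ 2 - 2 * b := by simpa using ht 0 0 1
    have t3 : Algebra.trace ℤ O (θ ^ 3) = -3 * c + a * b - a * (a ^ 2 - 2 * b) := by
      have e : θ ^ 3 = ((-c : ℤ) : O) + ((-b : ℤ) : O) * θ + ((-a : ℤ) : O) * θ ^ 2 := by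
        push_cast; linear_combination hθ
      rw [e, ht]; ring
    have t4 : Algebra.trace ℤ O (θ ^ 4) =
        3 * (a * c) - a * (a * b - c) + (a ^ 2 - 2 * b) * (a ^ 2 - b) := by
      have e : θ ^ 4 = ((a * c : ℤ) : O) + ((a * b - c : ℤ) : O) * θ
          + ((a ^ 2 - b : ℤ) : O) * θ ^ 2 := by
        push_cast; linear_combination (θ - a) * hθ
      rw [e, ht]
    rw [Algebra.discr_def, Matrix.det_fin_three]
    simp only [Algebra.traceMatrix_apply, Algebra.traceForm_apply]
    have q1 : θ * θ = θ ^ 2 := by ring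
    have q2 : θ * θ ^ 2 = θ ^ 3 := by ring
    have q3 : θ ^ 2 * θ = θ ^ 3 := by ring
    have q4 : θ ^ 2 * θ ^ 2 = θ ^ 4 := by ring
    simp [q1, q2, q3, q4, t0, t1, t2, t3, t4]
    ring

end Part4
section Part5
variable {k : Type*} [Field k] [NumberField k]

lemma aux_mem_l {I J : Ideal (𝓞 k)} {x : 𝓞 k} (h : x ∈ I * J) : x ∈ I := by
  have : I * J ≤ I := Ideal.mul_le_left
  exact this h

lemma aux_mem_r {I J : Ideal (𝓞 k)} {x : 𝓞 k} (h : x ∈ I * J) : x ∈ J := by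
  have : I * J ≤ J := Ideal.mul_le_right
  exact this h

lemma aux_mem_p {I : Ideal (𝓞 k)} {n : ℕ} (hn : n ≠ 0) {x : 𝓞 k} (h : x ∈ I ^ n) : x ∈ I := by
  have : I ^ n ≤ I := Ideal.pow_le_self hn
  exact this h

lemma aux_two_mem {I : Ideal (𝓞 k)} (h : Ideal.span {(2 : 𝓞 k)} = I) : (2 : 𝓞 k) ∈ I := by
  rw [← h]; exact Ideal.mem_span_singleton_self _

lemma aux_int_even {p : Ideal (𝓞 k)} (hp : p.IsPrime) (h2 : (2 : 𝓞 k) ∈ p) {n : ℤ}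
    (hn : (n : 𝓞 k) ∈ p) : n % 2 = 0 := by
  by_contra h
  have e : n = 2 * (n / 2) + 1 := by omega
  apply hp.ne_top
  rw [Ideal.eq_top_iff_one]
  have : (1 : 𝓞 k) = n - 2 * ((n / 2 : ℤ) : 𝓞 k) := by
    conv_rhs => rw [e]
    push_cast
    have : (2 * (n / 2) + 1) / 2 = n / 2 := by omega
    rw [this]; ring
  rw [this]
  exact sub_mem hn (Ideal.mul_mem_right _ _ h2)

lemma aux_coprime {p1 p2 : Ideal (𝓞 k)} (hp1 : p1.IsPrime) (hp2 : p2.IsPrime) (h1 : p1 ≠ ⊥)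
    (h2 : p2 ≠ ⊥) (hne : p1 ≠ p2) : IsCoprime p1 p2 := by
  have := hp1.isMaximal h1
  have := hp2.isMaximal h2
  exact Ideal.isCoprime_of_isMaximal hne

lemma aux_half {p1 p2 : Ideal (𝓞 k)} (hcop : IsCoprime p1 p2) (h2 : p2 ≠ ⊥)
    (h : Ideal.span {(2 : 𝓞 k)} = p1 ^ 2 * p2) (m : ℕ) (x : 𝓞 k) (hx : 2 * x ∈ p2 ^ (m + 1)) :
    x ∈ p2 ^ m := by
  rw [← Ideal.span_singleton_le_iff_mem, ← Ideal.dvd_iff_le] at hx ⊢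
  rw [← Ideal.span_singleton_mul_span_singleton, h, pow_succ', mul_comm (p1 ^ 2), mul_assoc] at hx
  have := (mul_dvd_mul_iff_left (a := p2) h2).mp hx
  exact (IsCoprime.pow (m := m) (n := 2) hcop.symm).dvd_of_dvd_mul_left this

lemma aux_mem_pow {p1 p2 : Ideal (𝓞 k)} (hp2 : p2.IsPrime) (hcop : IsCoprime p1 p2) (h2 : p2 ≠ ⊥)
    (h : Ideal.span {(2 : 𝓞 k)} = p1 ^ 2 * p2) (m : ℕ) : ∀ (n : ℤ), (n : 𝓞 k) ∈ p2 ^ m →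
    (2 : ℤ) ^ m ∣ n := by
  have h2m : (2 : 𝓞 k) ∈ p2 := by
    have : (2 : 𝓞 k) ∈ p1 ^ 2 * p2 := aux_two_mem h
    exact aux_mem_r this
  induction m with
  | zero => simp
  | succ m ih =>
    intro n hn
    have h0 := aux_int_even hp2 h2m (aux_mem_p (Nat.succ_ne_zero m) hn)
    obtain ⟨t, rfl⟩ : (2:ℤ) ∣ n := by omega
    push_cast at hn
    have := ih t (aux_half hcop h2 h m _ hn)
    rw [pow_succ']
    exact mul_dvd_mul_left 2 this

lemma aux_sq_mem {p : Ideal (𝓞 k)} (hp : p.IsPrime) (h0 : p ≠ ⊥) {θ : 𝓞 k} (h1 : θ ∈ p)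
    (h : θ ^ 2 ∈ p ^ 3) : θ ∈ p ^ 2 := by
  rw [← Ideal.span_singleton_le_iff_mem, ← Ideal.dvd_iff_le] at h h1 ⊢
  obtain ⟨q, hq⟩ := h1
  rw [← Ideal.span_singleton_pow, hq, mul_pow, pow_succ] at h
  have h' := (mul_dvd_mul_iff_left (pow_ne_zero 2 h0)).mp h
  have := (Ideal.prime_of_isPrime h0 hp).dvd_of_dvd_pow h'
  rw [hq, pow_two]
  exact mul_dvd_mul_left _ this

lemma aux_setup (h3 : Module.finrank ℚ k = 3) {p1 p2 : Ideal (𝓞 k)} (hp1 : p1.IsPrime)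
    (hp2 : p2.IsPrime) (hne : p1 ≠ p2) (h : Ideal.span {(2 : 𝓞 k)} = p1 ^ 2 * p2) :
    ∃ (θ : 𝓞 k) (a b c j : ℤ), θ - 1 ∈ p2 ^ 3 ∧ c % 4 = 2 ∧ b % 2 = 0 ∧ (1 + a + b + c) % 8 = 0 ∧
      j % 2 = 1 ∧ (∀ β : 𝓞 k, ∃ x y z : ℤ, (j : 𝓞 k) * β = x + y * θ + z * θ ^ 2) ∧
      (∀ x y z : ℤ, Algebra.norm ℤ (x + y * θ + z * θ ^ 2 : 𝓞 k) = auxNF a b c x y z) ∧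
      (∀ x y z : ℤ, Algebra.trace ℤ (𝓞 k) (x + y * θ + z * θ ^ 2 : 𝓞 k) =
        3 * x - a * y + (a ^ 2 - 2 * b) * z) ∧
      a ^ 2 * b ^ 2 - 4 * b ^ 3 - 4 * a ^ 3 * c + 18 * a * b * c - 27 * c ^ 2 =
        j ^ 2 * NumberField.discr k := by
  have h20 : Ideal.span {(2 : 𝓞 k)} ≠ ⊥ := by simp
  have hp10 : p1 ≠ ⊥ := by rintro rfl; apply h20; rw [h, pow_two]; simp
  have hp20 : p2 ≠ ⊥ := by rintro rfl; apply h20; rw [h]; simp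
  have hcop := aux_coprime hp1 hp2 hp10 hp20 hne
  have h2' : (2 : 𝓞 k) ∈ p1 ^ 2 * p2 := aux_two_mem h
  have h2p1 : (2 : 𝓞 k) ∈ p1 ^ 2 := aux_mem_l h2'
  have h2p2 : (2 : 𝓞 k) ∈ p2 := aux_mem_r h2'
  have h2p : (2 : 𝓞 k) ∈ p1 := aux_mem_p two_ne_zero h2p1
  -- choose θ
  have hlt : p1 ^ 2 < p1 := by
    have := Ideal.pow_right_strictAnti p1 hp10 hp1.ne_top (show 1 < 2 by norm_num)
    simpa using this
  obtain ⟨α, hα, hα2⟩ := SetLike.exists_of_lt hlt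
  obtain ⟨i, hi, j, hj, hij⟩ := Ideal.isCoprime_iff_exists.mp (IsCoprime.pow (m := 2) (n := 3) hcop)
  obtain ⟨θ, hθ⟩ : ∃ θ, θ = α * j + i := ⟨_, rfl⟩
  have hθα : θ - α ∈ p1 ^ 2 := by
    have : θ - α = (1 - α) * i := by rw [hθ]; linear_combination α * hij
    rw [this]; exact Ideal.mul_mem_left _ _ hi
  have hθ1 : θ ∈ p1 := by
    have := add_mem (aux_mem_p two_ne_zero hθα) hα
    simpa using this
  have hθ2 : θ ∉ p1 ^ 2 := by
    intro h'
    apply hα2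
    have := sub_mem h' hθα
    simpa using this
  have hθ3 : θ - 1 ∈ p2 ^ 3 := by
    have : θ - 1 = (α - 1) * j := by rw [hθ]; linear_combination hij
    rw [this]; exact Ideal.mul_mem_left _ _ hj
  have hθp2 : θ ∉ p2 := by
    intro h'
    apply hp2.ne_top
    rw [Ideal.eq_top_iff_one]
    have := sub_mem h' (aux_mem_p three_ne_zero hθ3)
    simpa using this
  have hsq : θ ^ 2 ∈ p1 ^ 2 := Ideal.pow_mem_pow hθ1 2
  -- integer multiples of θ in p1²
  have hmul : ∀ n : ℤ, (n : 𝓞 k) * θ ∈ p1 ^ 2 → n % 2 = 0 := by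
    intro n hn
    by_contra hodd
    obtain ⟨t, rfl⟩ : ∃ t, n = 2 * t + 1 := ⟨n / 2, by omega⟩
    apply hθ2
    have h1 : (2 : 𝓞 k) * (t * θ) ∈ p1 ^ 2 := Ideal.mul_mem_right _ _ h2p1
    have := sub_mem hn h1
    push_cast at this
    ring_nf at this
    exact this
  let B : Module.Basis (Fin 3) ℤ (𝓞 k) := Module.finBasisOfFinrankEq ℤ (𝓞 k) (aux_finrank h3)
  obtain ⟨a, b, c, hf⟩ := aux_cayley B θ
  have hdet : Odd (B.toMatrix ![1, θ, θ ^ 2]).det := by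
    apply aux_odd_det
    intro g hg
    have hg' : (g 0 : 𝓞 k) + g 1 * θ + g 2 * θ ^ 2 ∈ p1 ^ 2 * p2 := by
      rw [← h, Ideal.mem_span_singleton]
      simpa [Fin.sum_univ_three, zsmul_eq_mul] using hg
    have hg1 := aux_mem_l hg'
    have hg2 := aux_mem_r hg'
    have e0 : g 0 % 2 = 0 := by
      apply aux_int_even hp1 h2p
      have h1 := aux_mem_p two_ne_zero hg1
      have h4 : ((g 1 : 𝓞 k) + g 2 * θ) * θ ∈ p1 := Ideal.mul_mem_left _ _ hθ1
      have := sub_mem h1 h4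
      ring_nf at this
      exact this
    obtain ⟨t0, ht0⟩ : ∃ t, g 0 = 2 * t := ⟨g 0 / 2, by omega⟩
    have e1 : g 1 % 2 = 0 := by
      apply hmul
      have h1 : (2 : 𝓞 k) * t0 ∈ p1 ^ 2 := Ideal.mul_mem_right _ _ h2p1
      have h4 : (g 2 : 𝓞 k) * θ ^ 2 ∈ p1 ^ 2 := Ideal.mul_mem_left _ _ hsq
      have := sub_mem (sub_mem hg1 h1) h4
      rw [ht0] at this
      push_cast at this
      ring_nf at this
      exact this
    obtain ⟨t1, ht1⟩ : ∃ t, g 1 = 2 * t := ⟨g 1 / 2, by omega⟩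
    have e2 : g 2 % 2 = 0 := by
      apply aux_int_even hp2 h2p2
      have h1 : (2 : 𝓞 k) * (t0 + t1 * θ) ∈ p2 := Ideal.mul_mem_right _ _ h2p2
      have := sub_mem hg2 h1
      rw [ht0, ht1] at this
      push_cast at this
      ring_nf at this
      rcases hp2.mem_or_mem this with h5 | h5
      · first | exact h5 | exact absurd (hp2.mem_of_pow_mem _ h5) hθp2
      · first | exact h5 | exact absurd (hp2.mem_of_pow_mem _ h5) hθp2
    intro i
    fin_cases i
    · simpa using Int.dvd_of_emod_eq_zero e0
    · simpa using Int.dvd_of_emod_eq_zero e1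
    · simpa using Int.dvd_of_emod_eq_zero e2
  have hdet0 : (B.toMatrix ![1, θ, θ ^ 2]).det ≠ 0 := by
    intro h'; rw [h'] at hdet; exact absurd hdet (by decide)
  obtain ⟨f1, f2, f3⟩ := aux_formulas B θ a b c hf hdet0
  have hsum : (1 + a + b + c) % 8 = 0 := by
    have : ((1 + a + b + c : ℤ) : 𝓞 k) ∈ p2 ^ 3 := by
      have : ((1 + a + b + c : ℤ) : 𝓞 k) = (-(1 + θ + θ ^ 2 + a * (1 + θ) + b)) * (θ - 1) := by
        push_cast; linear_combination hf
      rw [this]; exact Ideal.mul_mem_left _ _ hθ3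
    have := aux_mem_pow hp2 hcop hp20 h 3 _ this
    omega
  have hc2 : c % 2 = 0 := by
    apply aux_int_even hp1 h2p
    have : (c : 𝓞 k) = -(θ ^ 2 + a * θ + b) * θ := by linear_combination hf
    rw [this]; exact Ideal.mul_mem_left _ _ hθ1
  obtain ⟨c', rfl⟩ : ∃ t, c = 2 * t := ⟨c / 2, by omega⟩
  have hb2 : b % 2 = 0 := by
    apply hmul
    have : (b : 𝓞 k) * θ = -((θ + a) * θ ^ 2 + c' * 2) := by
      push_cast at hf; linear_combination hf
    rw [this]
    exact neg_mem (add_mem (Ideal.mul_mem_left _ _ hsq) (Ideal.mul_mem_left _ _ h2p1))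
  obtain ⟨b', rfl⟩ : ∃ t, b = 2 * t := ⟨b / 2, by omega⟩
  have hc4 : (2 * c') % 4 = 2 := by
    by_contra hcon
    obtain ⟨d, rfl⟩ : ∃ d, c' = 2 * d := ⟨c' / 2, by omega⟩
    obtain ⟨a', rfl⟩ : ∃ t, a = 2 * t + 1 := ⟨a / 2, by omega⟩
    apply hθ2
    apply aux_sq_mem hp1 hp10 hθ1
    have m1 : (2 : 𝓞 k) * θ ∈ p1 ^ 3 := by
      rw [pow_succ]; exact Ideal.mul_mem_mul h2p1 hθ1
    have m2 : (2 : 𝓞 k) * 2 ∈ p1 ^ 3 := by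
      rw [pow_succ]; exact Ideal.mul_mem_mul h2p1 h2p
    have m3 : θ ^ 3 ∈ p1 ^ 3 := Ideal.pow_mem_pow hθ1 3
    have : θ ^ 2 = -(θ ^ 3 + (a' * θ + b') * (2 * θ) + d * (2 * 2)) := by
      push_cast at hf; linear_combination hf
    rw [this]
    exact neg_mem (add_mem (add_mem m3 (Ideal.mul_mem_left _ _ m1)) (Ideal.mul_mem_left _ _ m2))
  refine ⟨θ, a, 2 * b', 2 * c', (B.toMatrix ![1, θ, θ ^ 2]).det, hθ3, hc4, hb2, hsum,
    Int.odd_iff.mp hdet, ?_, f1, f2, ?_⟩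
  · intro β
    obtain ⟨w, hw⟩ := aux_span B ![1, θ, θ ^ 2] β
    exact ⟨w 0, w 1, w 2, by simpa [Fin.sum_univ_three, zsmul_eq_mul] using hw⟩
  · rw [← f3, aux_discr B, NumberField.discr_eq_discr]

end Part5
section Part6
variable {k : Type*} [Field k] [NumberField k]

lemma aux_wild (h3 : Module.finrank ℚ k = 3) {p1 p2 : Ideal (𝓞 k)} (hp1 : p1.IsPrime)
    (hp2 : p2.IsPrime) (hne : p1 ≠ p2) (h : Ideal.span {(2 : 𝓞 k)} = p1 ^ 2 * p2)
    (γ : 𝓞 k) (hγ : γ ∈ p2) : Even (Algebra.trace ℤ (𝓞 k) γ) := by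
  obtain ⟨θ, a, b, c, j, hθ, hc, hb, hs, hj, hspan, hN, hT, hD⟩ := aux_setup h3 hp1 hp2 hne h
  obtain ⟨x, y, z, hx⟩ := hspan γ
  have h2 : (2 : 𝓞 k) ∈ p2 := aux_mem_r (aux_two_mem h)
  have hθ' : θ - 1 ∈ p2 := aux_mem_p three_ne_zero hθ
  have e : (x + y + z) % 2 = 0 := by
    apply aux_int_even hp2 h2
    have h1 : (j : 𝓞 k) * γ ∈ p2 := Ideal.mul_mem_left _ _ hγ
    have h4 : ((y : 𝓞 k) + z * (θ + 1)) * (θ - 1) ∈ p2 := Ideal.mul_mem_left _ _ hθ'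
    have : ((x + y + z : ℤ) : 𝓞 k) = j * γ - ((y : 𝓞 k) + z * (θ + 1)) * (θ - 1) := by
      push_cast; linear_combination -hx
    rw [this]; exact sub_mem h1 h4
  have ht := hT x y z
  rw [← hx, ← zsmul_eq_mul, map_zsmul, smul_eq_mul] at ht
  obtain ⟨a', rfl⟩ : ∃ t, a = 2 * t + 1 := ⟨a / 2, by omega⟩
  obtain ⟨j', rfl⟩ : ∃ t, j = 2 * t + 1 := ⟨j / 2, by omega⟩
  rw [Int.even_iff]
  ring_nf at ht
  omega

lemma aux_disc_iff (a b c j D : ℤ) (hc : c % 4 = 2) (hb : b % 2 = 0) (hs : (1 + a + b + c) % 8 = 0)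
    (hj : j % 2 = 1)
    (hD : a ^ 2 * b ^ 2 - 4 * b ^ 3 - 4 * a ^ 3 * c + 18 * a * b * c - 27 * c ^ 2 = j ^ 2 * D) :
    D % 8 = 4 ↔ b % 4 = 0 := by
  obtain ⟨a', rfl⟩ : ∃ t, a = 2 * t + 1 := ⟨a / 2, by omega⟩
  obtain ⟨j', rfl⟩ : ∃ t, j = 2 * t + 1 := ⟨j / 2, by omega⟩
  obtain ⟨c', rfl⟩ : ∃ t, c = 4 * t + 2 := ⟨c / 4, by omega⟩
  obtain ⟨b', rfl⟩ : ∃ t, b = 2 * t := ⟨b / 2, by omega⟩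
  obtain ⟨m, hm⟩ : ∃ m, j' * (j' + 1) = 2 * m := by
    obtain ⟨m, hm⟩ := Int.even_mul_succ_self j'
    exact ⟨m, by omega⟩
  have h1 : (2 * j' + 1) ^ 2 * D = 8 * (m * D) + D := by linear_combination 4 * D * hm
  rw [h1] at hD
  rcases Int.even_or_odd' b' with ⟨t, rfl | rfl⟩
  · ring_nf at hD; omega
  · ring_nf at hD; omega

lemma aux_case3 (h3 : Module.finrank ℚ k = 3) {p1 p2 : Ideal (𝓞 k)} (hp1 : p1.IsPrime)
    (hp2 : p2.IsPrime) (hne : p1 ≠ p2) (h : Ideal.span {(2 : 𝓞 k)} = p1 ^ 2 * p2) :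
    (NumberField.discr k % 8 = 4 → (squareNormLift p2).index = 2) ∧
    (NumberField.discr k % 8 ≠ 4 → (squareNormLift p2).index = 1) := by
  have hdvd : p2 ∣ Ideal.span {(2 : 𝓞 k)} := ⟨p1 ^ 2, by rw [h, mul_comm]⟩
  obtain ⟨θ, a, b, c, j, hθ, hc, hb, hs, hj, hspan, hN, hT, hD⟩ := aux_setup h3 hp1 hp2 hne h
  have hiff := aux_disc_iff a b c j _ hc hb hs hj hD
  have h20 : Ideal.span {(2 : 𝓞 k)} ≠ ⊥ := by simp
  have hp10 : p1 ≠ ⊥ := by rintro rfl; apply h20; rw [h, pow_two]; simp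
  have hp20 : p2 ≠ ⊥ := by rintro rfl; apply h20; rw [h]; simp
  have hcop := aux_coprime hp1 hp2 hp10 hp20 hne
  have hθ' : θ - 1 ∈ p2 ^ 2 := by
    rw [pow_succ] at hθ
    exact aux_mem_l hθ
  refine ⟨fun hd => ?_, fun hd => ?_⟩
  · have hb4 := hiff.mp hd
    refine aux_index_two h3 hdvd fun β hβ hsq => ?_
    obtain ⟨s, hs'⟩ := hsq
    obtain ⟨x, y, z, hx⟩ := hspan (j * β)
    have hj4 : (j * j) % 4 = 1 := by
      obtain ⟨j', rfl⟩ : ∃ t, j = 2 * t + 1 := ⟨j / 2, by omega⟩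
      ring_nf; omega
    have hxyz : (x + y + z) % 4 = 1 := by
      have : ((x + y + z - j * j : ℤ) : 𝓞 k) ∈ p2 ^ 2 := by
        have e : ((x + y + z - j * j : ℤ) : 𝓞 k) =
            (j * j) * (β - 1) - ((y : 𝓞 k) + z * (θ + 1)) * (θ - 1) := by
          push_cast; linear_combination -hx
        rw [e]
        exact sub_mem (Ideal.mul_mem_left _ _ hβ) (Ideal.mul_mem_left _ _ hθ')
      have := aux_mem_pow hp2 hcop hp20 h 2 _ this
      omega
    have hs0 : s ≠ 0 := by
      rintro rfl
      have h0 : Algebra.norm ℤ β = 0 := by simpa using hs'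
      rw [Algebra.norm_eq_zero_iff] at h0
      rw [h0, zero_sub, neg_mem_iff] at hβ
      apply hp2.ne_top
      rw [Ideal.eq_top_iff_one]
      exact aux_mem_p two_ne_zero hβ
    refine aux_descent a b c hc hb4 hs _ (j ^ 3 * s) 1 x y z rfl
      (mul_ne_zero (pow_ne_zero _ (by omega)) hs0) (by norm_num) hxyz ?_
    rw [← hN, ← hx, map_mul, map_mul, aux_norm_int h3]
    linear_combination (-j ^ 6) * hs'
  · have hb4 : b % 4 = 2 := by
      have : b % 4 ≠ 0 := fun h' => hd (hiff.mpr h')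
      omega
    refine aux_index_one h3 hdvd (((1 : ℤ) : 𝓞 k) + ((-1 : ℤ) : 𝓞 k) * θ + ((1 : ℤ) : 𝓞 k) * θ ^ 2)
      ?_ ?_
    · have : ((1 : ℤ) : 𝓞 k) + ((-1 : ℤ) : 𝓞 k) * θ + ((1 : ℤ) : 𝓞 k) * θ ^ 2 - 1 = θ * (θ - 1) := by
        push_cast; ring
      rw [this]
      exact Ideal.mul_mem_left _ _ hθ'
    · rw [hN]
      have e1 : ((auxNF a b c 1 (-1) 1 : ℤ) : ZMod 4) = ((3 : ℤ) : ZMod 4) := by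
        rw [auxNF_cast, aux_cast_mod a 3 (by omega), aux_cast_mod b 2 (by omega),
          aux_cast_mod c 2 (by omega)]
        have := auxNF_mod_two
        push_cast
        exact this
      rw [ZMod.intCast_eq_intCast_iff] at e1
      exact e1

lemma aux_absNorm_two (h3 : Module.finrank ℚ k = 3) :
    Ideal.absNorm (Ideal.span {(2 : 𝓞 k)}) = 8 := by
  rw [Ideal.absNorm_span_singleton]
  have := aux_norm_int h3 2
  push_cast at this
  rw [this]; norm_num

lemma aux_main (h3 : Module.finrank ℚ k = 3)
    (c : Ideal (𝓞 k)) (hc : c ∣ Ideal.span {(2 : 𝓞 k)}) (C : Prop)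
    (hC : C = (c = Ideal.span {(2 : 𝓞 k)} ∨
       (∃ p1 p2 : Ideal (𝓞 k), p1.IsPrime ∧ p2.IsPrime ∧ p1 ≠ p2 ∧
          Ideal.absNorm p1 = 2 ∧ Ideal.absNorm p2 = 2 ∧
          Ideal.span {(2 : 𝓞 k)} = p1 ^ 2 * p2 ∧ c = p1 * p2) ∨
       (∃ p1 p2 : Ideal (𝓞 k), p1.IsPrime ∧ p2.IsPrime ∧ p1 ≠ p2 ∧
          Ideal.absNorm p1 = 2 ∧ Ideal.absNorm p2 = 2 ∧
          Ideal.span {(2 : 𝓞 k)} = p1 ^ 2 * p2 ∧ c = p2 ∧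
          NumberField.discr k % 8 = 4) ∨
       (∃ p1 : Ideal (𝓞 k), p1.IsPrime ∧
          Ideal.span {(2 : 𝓞 k)} = p1 ^ 3 ∧ c = p1 ^ 2))) :
    (C → (squareNormLift c).index = 2) ∧ (¬ C → (squareNormLift c).index = 1) := by
  have h20 : Ideal.span {(2 : 𝓞 k)} ≠ ⊥ := by simp
  constructor
  · rw [hC]
    rintro (h | ⟨p1, p2, hp1, hp2, hne, -, -, h, rfl⟩ | ⟨p1, p2, hp1, hp2, hne, -, -, h, rfl, hd⟩ |
      ⟨p1, hp1, h, rfl⟩)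
    · refine aux_index_two_trace h3 hc (Ideal.span {(2 : 𝓞 k)}) (by rw [h, pow_two]) ?_
      intro γ hγ
      exact aux_trace_nilp γ 1 (by simpa using hγ)
    · refine aux_index_two_trace h3 hc p2 (by rw [h]; ring) ?_
      exact aux_wild h3 hp1 hp2 hne h
    · exact (aux_case3 h3 hp1 hp2 hne h).1 hd
    · refine aux_index_two_trace h3 hc p1 (by rw [h]; ring) ?_
      intro γ hγ
      refine aux_trace_nilp γ 3 ?_
      rw [h]; exact Ideal.pow_mem_pow hγ 3
  · intro hnC
    rw [hC] at hnC
    -- the unramified situation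
    have unram : ∀ P Q : Ideal (𝓞 k), P.IsPrime → Ideal.span {(2 : 𝓞 k)} = P * Q → ¬ P ∣ Q → c ∣ Q →
        (squareNormLift c).index = 1 := by
      intro P Q hP hPQ hndvd hcQ
      have hP0 : P ≠ ⊥ := by rintro rfl; apply h20; rw [hPQ]; simp
      have hPm := hP.isMaximal hP0
      have hcop : IsCoprime P Q := by
        rw [Ideal.isCoprime_iff_sup_eq]
        by_contra hne
        have h1 : P = P ⊔ Q := hPm.eq_of_le hne le_sup_left
        apply hndvd
        rw [Ideal.dvd_iff_le, h1]
        exact le_sup_right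
      obtain ⟨γ, hγ, ht⟩ := aux_unram P Q hcop hPQ
      refine aux_index_one_trace h3 hc γ ?_ ht
      have h1 : c ^ 2 ∣ Ideal.span {(2 : 𝓞 k)} * Q := by
        rw [hPQ, mul_assoc, ← pow_two]
        exact Dvd.dvd.mul_left (pow_dvd_pow_of_dvd hcQ 2) P
      exact Ideal.dvd_iff_le.mp h1 (Ideal.mul_mem_mul (Ideal.mem_span_singleton_self _) hγ)
    obtain ⟨d, hd⟩ := hc
    have hd1 : ¬ IsUnit d := by
      rw [Ideal.isUnit_iff]
      rintro rfl
      exact hnC (.inl (by rw [hd]; simp))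
    have hd0 : d ≠ 0 := by
      rintro rfl; apply h20; rw [hd]; simp
    obtain ⟨p, hpp, hpd⟩ := WfDvdMonoid.exists_irreducible_factor hd1 hd0
    have hpp : Prime p := hpp.prime
    have hp : p.IsPrime := Ideal.isPrime_of_prime hpp
    by_cases hsq : p ^ 2 ∣ Ideal.span {(2 : 𝓞 k)}
    · obtain ⟨m, hm⟩ := hsq
      have hnorm := aux_absNorm_two h3
      rw [hm, map_mul, map_pow] at hnorm
      have hp1 : Ideal.absNorm p ≠ 1 := by
        rw [Ne, Ideal.absNorm_eq_one_iff]; exact hp.ne_top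
      have hp2 : Ideal.absNorm p = 2 := by
        have h1 : Ideal.absNorm p ^ 2 ≤ 8 := Nat.le_of_dvd (by norm_num) ⟨_, hnorm.symm⟩
        have h2 : Ideal.absNorm p ≤ 2 := by nlinarith
        interval_cases hh : Ideal.absNorm p
        · norm_num at hnorm
        · exact absurd rfl hp1
        · rfl
      have hm2 : Ideal.absNorm m = 2 := by rw [hp2] at hnorm; omega
      have hmp : m.IsPrime := Ideal.isPrime_of_irreducible_absNorm (by rw [hm2]; exact Nat.prime_two)
      have hm0 : m ≠ ⊥ := by rintro rfl; simp at hm2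
      by_cases hmeq : m = p
      · rw [hmeq, ← pow_succ] at hm
        have hcp : c ∣ p ^ 3 := ⟨d, by rw [← hd, hm]⟩
        obtain ⟨i, hi, hci⟩ := (dvd_prime_pow hpp 3).mp hcp
        rw [associated_iff_eq] at hci
        have hi1 : i ≤ 1 := by
          by_contra hcon
          have : i = 2 ∨ i = 3 := by omega
          rcases this with rfl | rfl
          · exact hnC (.inr (.inr (.inr ⟨p, hp, hm, hci⟩)))
          · exact hnC (.inl (by rw [hci, hm]))
        have h2 : (2 : 𝓞 k) ∈ c ^ 2 := by
          have : c ^ 2 ∣ Ideal.span {(2 : 𝓞 k)} := by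
            rw [hci, hm, ← pow_mul]; exact pow_dvd_pow _ (by omega)
          exact Ideal.dvd_iff_le.mp this (Ideal.mem_span_singleton_self _)
        refine aux_index_one h3 ⟨d, hd⟩ ((3 : ℤ) : 𝓞 k) ?_ ?_
        · have : ((3 : ℤ) : 𝓞 k) - 1 = 2 := by norm_num
          rw [this]; exact h2
        · rw [aux_norm_int h3]; norm_num
      · have hmprime : Prime m := Ideal.prime_of_isPrime hm0 hmp
        by_cases hmc : m ∣ c
        · obtain ⟨e, he⟩ := hmc
          have hep : e ∣ p ^ 2 := by
            refine ⟨d, ?_⟩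
            apply mul_left_cancel₀ hm0
            rw [← mul_assoc, ← he, ← hd, hm, mul_comm]
          obtain ⟨i, hi, hei⟩ := (dvd_prime_pow hpp 2).mp hep
          rw [associated_iff_eq] at hei
          interval_cases i
          · have hcm : c = m := by rw [he, hei]; simp
            have hdis : NumberField.discr k % 8 ≠ 4 := fun hdis =>
              hnC (.inr (.inr (.inl ⟨p, m, hp, hmp, Ne.symm hmeq, hp2, hm2, hm, hcm, hdis⟩)))
            rw [hcm]
            exact (aux_case3 h3 hp hmp (Ne.symm hmeq) hm).2 hdis
          · exact absurd (.inr (.inl ⟨p, m, hp, hmp, Ne.symm hmeq, hp2, hm2, hm, by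
              rw [he, hei, pow_one, mul_comm]⟩)) hnC
          · exact absurd (.inl (by rw [he, hei, hm, mul_comm])) hnC
        · have hmd : m ∣ d := by
            have : m ∣ c * d := by rw [← hd, hm]; exact Dvd.intro_left _ rfl
            exact (hmprime.dvd_or_dvd this).resolve_left hmc
          obtain ⟨d', hd'⟩ := hmd
          refine unram m (p ^ 2) hmp (by rw [hm, mul_comm]) ?_ ⟨d', ?_⟩
          · intro hmp2
            have := hmprime.dvd_of_dvd_pow hmp2
            rw [hmprime.dvd_prime_iff_associated hpp, associated_iff_eq] at this
            exact hmeq this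
          · apply mul_left_cancel₀ hm0
            rw [mul_comm m, ← hm, hd, hd']; ring
    · obtain ⟨d', hd'⟩ := hpd
      refine unram p (c * d') hp (by rw [hd, hd']; ring) ?_ (Dvd.intro _ rfl)
      intro hdvd
      apply hsq
      rw [hd, hd', pow_two]
      have : c * (p * d') = p * (c * d') := by ring
      rw [this]
      exact mul_dvd_mul_left _ hdvd

end Part6
/-- Let `k` be a cubic field and `c` a nonzero ideal of `𝓞 k` dividing
`2 𝓞 k`.  Then `z_k(c) = [Z_c : Z_c[N]] = 2` if and only if one of the following holds:
(i) `c = 2 𝓞 k`;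
(ii) `2 𝓞 k = p1² p2` with `p1 ≠ p2` primes of residue degree 1 and `c = p1 p2`;
(iii) `2 𝓞 k = p1² p2` as in (ii), `c = p2`, and `Disc(k) ≡ 4 (mod 8)`;
(iv) `2 𝓞 k = p1³` and `c = p1²`.
In all other cases `z_k(c) = 1`. -/
theorem statement7 (k : Type*) [Field k] [NumberField k]
    (h3 : Module.finrank ℚ k = 3)
    (c : Ideal (𝓞 k)) (hc0 : c ≠ ⊥) (hc : c ∣ Ideal.span {(2 : 𝓞 k)}) :
    ((squareNormLift c).index = 2 ↔
      (c = Ideal.span {(2 : 𝓞 k)} ∨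
       (∃ p1 p2 : Ideal (𝓞 k), p1.IsPrime ∧ p2.IsPrime ∧ p1 ≠ p2 ∧
          Ideal.absNorm p1 = 2 ∧ Ideal.absNorm p2 = 2 ∧
          Ideal.span {(2 : 𝓞 k)} = p1 ^ 2 * p2 ∧ c = p1 * p2) ∨
       (∃ p1 p2 : Ideal (𝓞 k), p1.IsPrime ∧ p2.IsPrime ∧ p1 ≠ p2 ∧
          Ideal.absNorm p1 = 2 ∧ Ideal.absNorm p2 = 2 ∧
          Ideal.span {(2 : 𝓞 k)} = p1 ^ 2 * p2 ∧ c = p2 ∧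
          NumberField.discr k % 8 = 4) ∨
       (∃ p1 : Ideal (𝓞 k), p1.IsPrime ∧
          Ideal.span {(2 : 𝓞 k)} = p1 ^ 3 ∧ c = p1 ^ 2))) ∧
    (¬ (c = Ideal.span {(2 : 𝓞 k)} ∨
       (∃ p1 p2 : Ideal (𝓞 k), p1.IsPrime ∧ p2.IsPrime ∧ p1 ≠ p2 ∧
          Ideal.absNorm p1 = 2 ∧ Ideal.absNorm p2 = 2 ∧
          Ideal.span {(2 : 𝓞 k)} = p1 ^ 2 * p2 ∧ c = p1 * p2) ∨
       (∃ p1 p2 : Ideal (𝓞 k), p1.IsPrime ∧ p2.IsPrime ∧ p1 ≠ p2 ∧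
          Ideal.absNorm p1 = 2 ∧ Ideal.absNorm p2 = 2 ∧
          Ideal.span {(2 : 𝓞 k)} = p1 ^ 2 * p2 ∧ c = p2 ∧
          NumberField.discr k % 8 = 4) ∨
       (∃ p1 : Ideal (𝓞 k), p1.IsPrime ∧
          Ideal.span {(2 : 𝓞 k)} = p1 ^ 3 ∧ c = p1 ^ 2)) →
      (squareNormLift c).index = 1) := by
  obtain ⟨h1, h2⟩ := aux_main h3 c hc _ rfl
  refine ⟨⟨fun h => ?_, h1⟩, h2⟩
  by_contra hn
  rw [h2 hn] at h
  exact absurd h (by norm_num)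
end

section
/- Let k be a cubic field with discriminant Disc(k). Then 2 is totally ramified in k (i.e., 2*Z_k = p^3 for a prime ideal p) if and only if Disc(k) ≡ 20 (mod 32), and 2 is partially ramified in k (i.e., 2*Z_k = p1^2 * p2 with p1 ≠ p2) if and only if Disc(k) ≡ 8 or 12 (mod 16). In particular, the 2-adic valuation of Disc(k) is at most 3, and Disc(k) is never congruent to 4 modulo 32. -/
open NumberField

namespace Cubic2

/-- Cayley-Hamilton for 3x3 integer matrices with traces. -/
lemma matrix_ch (A : Matrix (Fin 3) (Fin 3) ℤ) : ∃ a b c : ℤ,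
    A * A * A + a • (A * A) + b • A + c • (1 : Matrix (Fin 3) (Fin 3) ℤ) = 0 ∧
    A.trace = -a ∧ (A * A).trace = a ^ 2 - 2 * b := by
  obtain ⟨a, b, c, d, e, f, g, h, i, rfl⟩ : ∃ a b c d e f g h i : ℤ,
      A = !![a, b, c; d, e, f; g, h, i] := ⟨_, _, _, _, _, _, _, _, _, Matrix.eta_fin_three A⟩
  refine ⟨-(a + e + i), a * e - b * d + a * i - c * g + e * i - f * h,
    -(a * e * i - a * f * h - b * d * i + b * f * g + c * d * h - c * e * g), ?_, ?_, ?_⟩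
  · rw [Matrix.one_fin_three]
    simp only [Matrix.mul_fin_three, Matrix.smul_of, Matrix.smul_cons, Matrix.smul_empty,
      smul_eq_mul]
    ext x y
    fin_cases x <;> fin_cases y <;> simp [Matrix.add_apply] <;> ring
  · simp [Matrix.trace, Fin.sum_univ_three]
  · simp [Matrix.trace, Fin.sum_univ_three]; ring

lemma cubic_rel {S : Type*} [CommRing S] (B : Module.Basis (Fin 3) ℤ S) (x : S) :
    ∃ a b c : ℤ, x ^ 3 + a * x ^ 2 + b * x + c = 0 ∧
      Algebra.discr ℤ ![1, x, x ^ 2] =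
        a ^ 2 * b ^ 2 - 4 * b ^ 3 - 4 * a ^ 3 * c - 27 * c ^ 2 + 18 * a * b * c := by
  obtain ⟨a, b, c, h, h1, h2⟩ := matrix_ch (Algebra.leftMulMatrix B x)
  have hrel : x ^ 3 + a * x ^ 2 + b * x + c = 0 := by
    apply Algebra.leftMulMatrix_injective B
    rw [map_zero, ← h]
    have e : x ^ 3 + a * x ^ 2 + b * x + c = x * x * x + a • (x * x) + b • x + c • (1 : S) := by
      simp only [zsmul_eq_mul]; ring
    rw [e]
    simp only [map_add, map_mul, map_zsmul, map_one]
  have t0 : Algebra.trace ℤ S 1 = 3 := by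
    rw [Algebra.trace_eq_matrix_trace B]; simp
  have t1 : Algebra.trace ℤ S x = -a := by
    rw [Algebra.trace_eq_matrix_trace B, h1]
  have t2 : Algebra.trace ℤ S (x ^ 2) = a ^ 2 - 2 * b := by
    rw [Algebra.trace_eq_matrix_trace B, pow_two, map_mul, h2]
  have t3 : Algebra.trace ℤ S (x ^ 3) = -a * (a ^ 2 - 2 * b) - b * (-a) - c * 3 := by
    have e : x ^ 3 = -a • x ^ 2 - b • x - c • (1 : S) := by
      simp only [zsmul_eq_mul]; push_cast; linear_combination hrel
    rw [e]; simp only [map_sub, map_zsmul, t0, t1, t2, smul_eq_mul]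
  have t4 : Algebra.trace ℤ S (x ^ 4) = -a * (-a * (a ^ 2 - 2 * b) - b * (-a) - c * 3)
      - b * (a ^ 2 - 2 * b) - c * (-a) := by
    have e : x ^ 4 = -a • x ^ 3 - b • x ^ 2 - c • x := by
      simp only [zsmul_eq_mul]; push_cast; linear_combination x * hrel
    rw [e]; simp only [map_sub, map_zsmul, t1, t2, t3, smul_eq_mul]
  refine ⟨a, b, c, hrel, ?_⟩
  have m1 : x * x ^ 2 = x ^ 3 := by ring
  have m2 : x ^ 2 * x = x ^ 3 := by ring
  have m3 : x ^ 2 * x ^ 2 = x ^ 4 := by ring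
  have m4 : x * x = x ^ 2 := by ring
  rw [Algebra.discr_def, Matrix.det_fin_three]
  simp only [Algebra.traceMatrix_apply, Algebra.traceForm_apply, Matrix.cons_val, one_mul, mul_one,
    m1, m2, m3, m4, t0, t1, t2, t3, t4]
  ring

/-- If `1, x, x²` are independent mod 2, the index is odd. -/
lemma index_odd {S : Type*} [CommRing S] (B : Module.Basis (Fin 3) ℤ S) (x : S)
    (hx : ∀ u v w : ℤ, (u + v * x + w * x ^ 2 : S) ∈ Ideal.span {(2 : S)} →
      2 ∣ u ∧ 2 ∣ v ∧ 2 ∣ w) :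
    ∃ i : ℤ, i % 2 = 1 ∧ Algebra.discr ℤ ![1, x, x ^ 2] = i ^ 2 * Algebra.discr ℤ B := by
  refine ⟨(B.toMatrix ![1, x, x ^ 2]).det, ?_, ?_⟩
  · by_contra hne
    have h2 : (2 : ℤ) ∣ (B.toMatrix ![1, x, x ^ 2]).det := by omega
    set M := B.toMatrix ![1, x, x ^ 2] with hM
    have h0 : (M.map (Int.castRingHom (ZMod 2))).det = 0 := by
      rw [← RingHom.mapMatrix_apply, ← RingHom.map_det]
      exact (ZMod.intCast_zmod_eq_zero_iff_dvd _ 2).2 (by exact_mod_cast h2)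
    obtain ⟨v, hv, hv0⟩ := Matrix.exists_mulVec_eq_zero_iff.2 h0
    let w : Fin 3 → ℤ := fun i => (v i).val
    have hw : ∀ i, ((w i : ℤ) : ZMod 2) = v i := fun i => by simp [w]
    have hdiv : ∀ i, (2 : ℤ) ∣ (M.mulVec w) i := by
      intro i
      have := congrFun hv0 i
      refine (ZMod.intCast_zmod_eq_zero_iff_dvd _ 2).1 ?_
      rw [Pi.zero_apply] at this
      rw [← this]
      simp [Matrix.mulVec, dotProduct, hw]
    choose z hz using hdiv
    have key : (w 0 + w 1 * x + w 2 * x ^ 2 : S) = 2 * ∑ i, z i • B i := by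
      have hs : ∀ j, ∑ i, M i j • B i = ![1, x, x ^ 2] j := fun j =>
        B.sum_toMatrix_smul_self ![1, x, x ^ 2] j
      have : (w 0 + w 1 * x + w 2 * x ^ 2 : S) = ∑ j, w j • ![1, x, x ^ 2] j := by
        simp [Fin.sum_univ_three]
      rw [this]
      simp_rw [← hs, Finset.smul_sum]
      rw [Finset.sum_comm, Finset.mul_sum]
      refine Finset.sum_congr rfl fun i _ => ?_
      have h2 := hz i
      simp only [Matrix.mulVec, dotProduct] at h2
      simp_rw [smul_smul]
      rw [← Finset.sum_smul]
      simp_rw [mul_comm (w _)]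
      rw [h2, mul_smul]
      simp
    have := hx _ _ _ (by rw [key]; exact Ideal.mul_mem_right _ _ (Ideal.mem_span_singleton_self _))
    apply hv
    ext i
    have : (2 : ℤ) ∣ w i := by fin_cases i <;> simp_all
    rw [← hw, Pi.zero_apply]
    congr 1
    exact (ZMod.intCast_zmod_eq_zero_iff_dvd _ 2).2 (by exact_mod_cast this)
  · rw [← Algebra.discr_of_matrix_vecMul]
    rw [B.toMatrix_map_vecMul]

/-- cancel a uniformizer -/
lemma cancel {S : Type*} [CommRing S] [IsDedekindDomain S] (p : Ideal S) [hp : p.IsPrime]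
    (hp0 : p ≠ ⊥) {x y : S} (hx : x ∈ p) (hx2 : x ∉ p ^ 2) {n : ℕ} (h : x * y ∈ p ^ (n + 1)) :
    y ∈ p ^ n := by
  obtain ⟨J, hJ⟩ := Ideal.dvd_span_singleton.2 hx
  have hJp : ¬ J ≤ p := by
    intro hle
    apply hx2
    rw [← Ideal.dvd_span_singleton, hJ, pow_two]
    exact mul_dvd_mul_left _ (Ideal.dvd_iff_le.2 hle)
  obtain ⟨j, hj, hjp⟩ := Set.not_subset.1 hJp
  have h1 : p ^ (n + 1) ∣ p * (J * Ideal.span {y}) := by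
    rw [← mul_assoc, ← hJ, Ideal.span_singleton_mul_span_singleton]
    exact Ideal.dvd_span_singleton.2 h
  rw [pow_succ', mul_dvd_mul_iff_left (by simpa using hp0)] at h1
  have h2 : j * y ∈ p ^ n := Ideal.dvd_iff_le.1 h1
    (Ideal.mul_mem_mul hj (Ideal.mem_span_singleton_self y))
  rcases Ideal.IsPrime.mul_mem_pow p h2 with h | h
  · exact absurd h hjp
  · exact h

lemma int_even {S : Type*} [CommRing S] (p : Ideal S) (hp : p ≠ ⊤) (h2 : (2 : S) ∈ p) (n : ℤ)
    (h : (n : S) ∈ p) : 2 ∣ n := by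
  by_contra hn
  apply hp
  rw [Ideal.eq_top_iff_one]
  obtain ⟨m, rfl⟩ : ∃ m, n = 2 * m + 1 := ⟨n / 2, by omega⟩
  have e : (1 : S) = ((2 * m + 1 : ℤ) : S) - 2 * m := by push_cast; ring
  rw [e]
  exact p.sub_mem h (p.mul_mem_right _ h2)

lemma exists_unif {S : Type*} [CommRing S] [IsDedekindDomain S] (p : Ideal S) [hp : p.IsPrime]
    (hp0 : p ≠ ⊥) : ∃ x ∈ p, x ∉ p ^ 2 := by
  have := Ideal.pow_succ_lt_pow (P := p) hp0 1
  obtain ⟨x, h1, h2⟩ := SetLike.exists_of_lt this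
  exact ⟨x, by simpa using h1, h2⟩

lemma arith_sq (i : ℤ) (hi : i % 2 = 1) : ∃ m, i ^ 2 = 8 * m + 1 := by
  obtain ⟨j, rfl⟩ : ∃ m, i = 2 * m + 1 := ⟨i / 2, by omega⟩
  obtain ⟨l, hl⟩ := Int.even_mul_succ_self j
  exact ⟨l, by linear_combination 4 * hl⟩

lemma total {S : Type*} [CommRing S] [IsDedekindDomain S] [CharZero S]
    (B : Module.Basis (Fin 3) ℤ S) (p : Ideal S) [hp : p.IsPrime]
    (h : Ideal.span {(2 : S)} = p ^ 3) : Algebra.discr ℤ B % 32 = 20 := by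
  have hp0 : p ≠ ⊥ := by
    rintro rfl
    rw [← Ideal.zero_eq_bot] at h
    simp only [ne_eq, OfNat.ofNat_ne_zero, not_false_eq_true, zero_pow, zero_mul,
      mul_zero] at h
    exact two_ne_zero (Ideal.span_singleton_eq_bot.1 h)
  have m2 : (2 : S) ∈ p ^ 3 := h ▸ Ideal.mem_span_singleton_self _
  have m1 : (2 : S) ∈ p := Ideal.pow_le_self (by norm_num) m2
  obtain ⟨x, hx, hx2⟩ := exists_unif p hp0
  have ev := int_even p hp.ne_top m1
  have ev' : ∀ n : ℤ, 2 ∣ n → (n : S) ∈ p ^ 3 := by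
    rintro _ ⟨m, rfl⟩
    push_cast
    exact Ideal.mul_mem_right _ _ m2
  have c1 : ∀ y, x * y ∈ p ^ 2 → y ∈ p := fun y hy => by
    simpa using cancel p hp0 hx hx2 (n := 1) hy
  have ind : ∀ u v w : ℤ, (u + v * x + w * x ^ 2 : S) ∈ p ^ 3 → 2 ∣ u ∧ 2 ∣ v ∧ 2 ∣ w := by
    intro u v w hh
    have hu : 2 ∣ u := ev u (by
      have : (u : S) = (u + v * x + w * x ^ 2 : S) - x * (v + w * x) := by ring
      rw [this]
      exact p.sub_mem (Ideal.pow_le_self (by norm_num) hh) (p.mul_mem_right _ hx))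
    have h3 : x * (v + w * x : S) ∈ p ^ 3 := by
      have : x * (v + w * x : S) = (u + v * x + w * x ^ 2 : S) - u := by ring
      rw [this]
      exact Ideal.sub_mem _ hh (ev' _ hu)
    have h4 := cancel p hp0 hx hx2 (n := 2) h3
    have hv : 2 ∣ v := ev v (by
      have : (v : S) = (v + w * x : S) - x * w := by ring
      rw [this]
      exact p.sub_mem (Ideal.pow_le_self (by norm_num) h4) (p.mul_mem_right _ hx))
    have h5 : x * (w : S) ∈ p ^ 2 := by
      have : x * (w : S) = (v + w * x : S) - v := by ring
      rw [this]
      exact Ideal.sub_mem _ h4 (Ideal.pow_le_pow_right (by norm_num) (ev' _ hv))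
    exact ⟨hu, hv, ev _ (c1 _ h5)⟩
  obtain ⟨i, hi, hd⟩ := index_odd B x (by rw [h]; exact ind)
  obtain ⟨a, b, c, hrel, hdisc⟩ := cubic_rel B x
  obtain ⟨hc, hb, ha⟩ := ind c b a (by
    have : (c + b * x + a * x ^ 2 : S) = - x ^ 3 := by linear_combination hrel
    rw [this]
    exact neg_mem (Ideal.pow_mem_pow hx 3))
  obtain ⟨a, rfl⟩ := ha
  obtain ⟨b, rfl⟩ := hb
  obtain ⟨c, rfl⟩ := hc
  have hco : ¬ 2 ∣ c := by
    rintro ⟨c, rfl⟩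
    have h4 : (2 * x : S) ∈ p ^ 4 := by
      rw [pow_succ]; exact Ideal.mul_mem_mul m2 hx
    have h6 : (2 * 2 : S) ∈ p ^ 4 := by
      rw [pow_succ]; exact Ideal.mul_mem_mul m2 m1
    have h7 : x * (x * (x * 1)) ∈ p ^ 4 := by
      have : x * (x * (x * 1)) = (2 * x) * (- (a * x + b)) + (2 * 2) * (- c) := by
        push_cast at hrel
        linear_combination hrel
      rw [this]
      exact Ideal.add_mem _ (Ideal.mul_mem_right _ _ h4) (Ideal.mul_mem_right _ _ h6)
    have := cancel p hp0 hx hx2 (cancel p hp0 hx hx2 (cancel p hp0 hx hx2 h7))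
    exact hp.ne_top ((Ideal.eq_top_iff_one _).2 (by simpa using this))
  obtain ⟨m, hm⟩ := arith_sq i hi
  obtain ⟨n, hn⟩ := arith_sq c (by omega)
  rw [hd, hm] at hdisc
  obtain ⟨t, ht⟩ : ∃ t, a * b * (a * b + c) = 2 * t := by
    obtain ⟨c', rfl⟩ : ∃ m, c = 2 * m + 1 := ⟨c / 2, by omega⟩
    obtain ⟨l, hl⟩ := Int.even_mul_succ_self (a * b)
    exact ⟨l + a * b * c', by linear_combination hl⟩
  generalize Algebra.discr ℤ B = D at hdisc
  have : (8 * m + 1) * D = 32 * (t - b ^ 3 - 2 * a ^ 3 * c + 4 * a * b * c) - 108 * (8 * n + 1) := by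
    rw [← hn]; linear_combination hdisc + 16 * ht
  have h4 : D % 4 = 0 := by
    have : D = 4 * (8 * (t - b ^ 3 - 2 * a ^ 3 * c + 4 * a * b * c) - 27 * (8 * n + 1) - 2 * m * D) := by
      linear_combination this
    omega
  obtain ⟨E, rfl⟩ : ∃ E, D = 4 * E := ⟨D / 4, by omega⟩
  have : 4 * E = 32 * (t - b ^ 3 - 2 * a ^ 3 * c + 4 * a * b * c - 27 * n - m * E) - 108 := by
    linear_combination this
  omega

lemma arith_partial (a b c i D : ℤ) (hi : i % 2 = 1) (ha : a % 2 = 1) (hco : c % 2 = 1)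
    (hdisc : i ^ 2 * D = a ^ 2 * (2 * b) ^ 2 - 4 * (2 * b) ^ 3 - 4 * a ^ 3 * (2 * c)
      - 27 * (2 * c) ^ 2 + 18 * a * (2 * b) * (2 * c)) : D % 16 = 8 ∨ D % 16 = 12 := by
  obtain ⟨m, hm⟩ := arith_sq i hi
  obtain ⟨n, hn⟩ := arith_sq c (by omega)
  obtain ⟨r, hr⟩ := arith_sq a (by omega)
  rw [hm] at hdisc
  obtain ⟨s, hs⟩ : ∃ s, a * c = 2 * s + 1 := by
    obtain ⟨c', rfl⟩ : ∃ m, c = 2 * m + 1 := ⟨c / 2, by omega⟩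
    obtain ⟨a', rfl⟩ : ∃ m, a = 2 * m + 1 := ⟨a / 2, by omega⟩
    exact ⟨2 * a' * c' + a' + c', by ring⟩
  have : (8 * m + 1) * D = 4 * (8 * r + 1) * b ^ 2 - 32 * b ^ 3 - 8 * (8 * r + 1) * (2 * s + 1)
      - 108 * (8 * n + 1) + 72 * b * (2 * s + 1) := by
    rw [← hn, ← hr, ← hs]; linear_combination hdisc
  have h4 : D % 4 = 0 := by
    have : D = 4 * ((8 * r + 1) * b ^ 2 - 8 * b ^ 3 - 2 * (8 * r + 1) * (2 * s + 1)
      - 27 * (8 * n + 1) + 18 * b * (2 * s + 1) - 2 * m * D) := by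
      linear_combination this
    omega
  obtain ⟨E, rfl⟩ : ∃ E, D = 4 * E := ⟨D / 4, by omega⟩
  have h5 : 4 * E = 16 * (2 * r * b ^ 2 - 2 * b ^ 3 - r * (8 * s + 4) - s - 54 * n + 9 * b * s
      - 2 * m * E) + 4 * b ^ 2 - 8 - 108 + 72 * b := by
    linear_combination this
  rcases Int.even_or_odd' b with ⟨d, rfl | rfl⟩
  · right
    have : 4 * (2 * d) ^ 2 = 16 * d ^ 2 := by ring
    omega
  · left
    have : 4 * (2 * d + 1) ^ 2 = 16 * (d ^ 2 + d) + 4 := by ring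
    omega

lemma exists_unif_two {S : Type*} [CommRing S] [IsDedekindDomain S] (p q : Ideal S)
    [hp : p.IsPrime] [hq : q.IsPrime] (hpq : p ≠ q) (hp0 : p ≠ ⊥) (hq0 : q ≠ ⊥) :
    ∃ x, x ∈ p ∧ x ∉ p ^ 2 ∧ x - 1 ∈ q := by
  obtain ⟨x, hx, hx2⟩ := exists_unif p hp0
  have := hp.isMaximal hp0
  have := hq.isMaximal hq0
  have hcop : IsCoprime (p ^ 2) q := by
    apply IsCoprime.pow_left
    exact Ideal.isCoprime_of_isMaximal hpq
  obtain ⟨u, hu, v, hv, huv⟩ := Ideal.isCoprime_iff_exists.1 hcop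
  have hxu : x + (1 - x) * u - x = (1 - x) * u := by ring
  have hmem : (1 - x) * u ∈ p ^ 2 := Ideal.mul_mem_left _ _ hu
  refine ⟨x + (1 - x) * u, p.add_mem hx (Ideal.pow_le_self (by norm_num) hmem), ?_, ?_⟩
  · intro hh
    exact hx2 (by simpa using Ideal.sub_mem _ hh hmem)
  · have : x + (1 - x) * u - 1 = v * (x - 1) := by linear_combination (1 - x) * huv
    rw [this]
    exact Ideal.mul_mem_right _ _ hv

lemma partially {S : Type*} [CommRing S] [IsDedekindDomain S] [CharZero S]
    (B : Module.Basis (Fin 3) ℤ S) (p q : Ideal S) [hp : p.IsPrime] [hq : q.IsPrime] (hpq : p ≠ q)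
    (h : Ideal.span {(2 : S)} = p ^ 2 * q) :
    Algebra.discr ℤ B % 16 = 8 ∨ Algebra.discr ℤ B % 16 = 12 := by
  have hp0 : p ≠ ⊥ := by
    rintro rfl
    rw [← Ideal.zero_eq_bot] at h
    simp only [ne_eq, OfNat.ofNat_ne_zero, not_false_eq_true, zero_pow, zero_mul,
      mul_zero] at h
    exact two_ne_zero (Ideal.span_singleton_eq_bot.1 h)
  have hq0 : q ≠ ⊥ := by
    rintro rfl
    rw [← Ideal.zero_eq_bot] at h
    simp only [ne_eq, OfNat.ofNat_ne_zero, not_false_eq_true, zero_pow, zero_mul,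
      mul_zero] at h
    exact two_ne_zero (Ideal.span_singleton_eq_bot.1 h)
  have m0 : (2 : S) ∈ p ^ 2 * q := by
    rw [← h]; exact Ideal.mem_span_singleton_self _
  have le1 : p ^ 2 * q ≤ p ^ 2 := Ideal.mul_le_left
  have le2 : p ^ 2 * q ≤ q := Ideal.mul_le_right
  have m2 : (2 : S) ∈ p ^ 2 := le1 m0
  have mq : (2 : S) ∈ q := le2 m0
  have m1 : (2 : S) ∈ p := Ideal.pow_le_self (by norm_num) m2
  obtain ⟨x, hx, hx2, hxq⟩ := exists_unif_two p q hpq hp0 hq0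
  have ev := int_even p hp.ne_top m1
  have evq := int_even q hq.ne_top mq
  have ev' : ∀ n : ℤ, 2 ∣ n → (n : S) ∈ p ^ 2 := by
    rintro _ ⟨m, rfl⟩
    push_cast
    exact Ideal.mul_mem_right _ _ m2
  have evq' : ∀ n : ℤ, 2 ∣ n → (n : S) ∈ q := by
    rintro _ ⟨m, rfl⟩
    push_cast
    exact Ideal.mul_mem_right _ _ mq
  have c1 : ∀ y, x * y ∈ p ^ 2 → y ∈ p := fun y hy => by
    simpa using cancel p hp0 hx hx2 (n := 1) hy
  have ind0 : ∀ (u v : ℤ) (w : S), (u + v * x + w * x ^ 2 : S) ∈ p ^ 2 → 2 ∣ u ∧ 2 ∣ v := by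
    intro u v w hh
    have hu : 2 ∣ u := ev u (by
      have : (u : S) = (u + v * x + w * x ^ 2 : S) - x * (v + w * x) := by ring
      rw [this]
      exact p.sub_mem (Ideal.pow_le_self (by norm_num) hh) (p.mul_mem_right _ hx))
    have h3 : x * (v + w * x : S) ∈ p ^ 2 := by
      have : x * (v + w * x : S) = (u + v * x + w * x ^ 2 : S) - u := by ring
      rw [this]
      exact Ideal.sub_mem _ hh (ev' _ hu)
    have h4 := c1 _ h3
    have hv : 2 ∣ v := ev v (by
      have : (v : S) = (v + w * x : S) - x * w := by ring
      rw [this]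
      exact p.sub_mem h4 (p.mul_mem_right _ hx))
    exact ⟨hu, hv⟩
  have ind : ∀ u v w : ℤ, (u + v * x + w * x ^ 2 : S) ∈ p ^ 2 * q → 2 ∣ u ∧ 2 ∣ v ∧ 2 ∣ w := by
    intro u v w hh
    obtain ⟨hu, hv⟩ := ind0 u v w (le1 hh)
    refine ⟨hu, hv, evq w ?_⟩
    have : (w : S) = (u + v * x + w * x ^ 2 : S) - u - v * x - (x - 1) * (w * (x + 1)) := by ring
    rw [this]
    refine q.sub_mem (q.sub_mem (q.sub_mem (le2 hh) (evq' _ hu))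
      (q.mul_mem_right _ (evq' _ hv))) (q.mul_mem_right _ hxq)
  obtain ⟨i, hi, hd⟩ := index_odd B x (by rw [h]; exact ind)
  obtain ⟨a, b, c, hrel, hdisc⟩ := cubic_rel B x
  obtain ⟨hc, hb⟩ := ind0 c b (a + x) (by
    have : (c + b * x + (a + x) * x ^ 2 : S) = 0 := by linear_combination hrel
    rw [this]
    exact Ideal.zero_mem _)
  have ha : 2 ∣ 1 + a + b + c := evq _ (by
    have : ((1 + a + b + c : ℤ) : S) = (x - 1) * (-(x ^ 2 + x + 1 + a * (x + 1) + b)) := by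
      push_cast; linear_combination hrel
    rw [this]
    exact q.mul_mem_right _ hxq)
  obtain ⟨b, rfl⟩ := hb
  obtain ⟨c, rfl⟩ := hc
  have hco : ¬ 2 ∣ c := by
    rintro ⟨c, rfl⟩
    have h4 : (2 * x : S) ∈ p ^ 3 := by
      rw [pow_succ]; exact Ideal.mul_mem_mul m2 hx
    have h6 : (2 * 2 : S) ∈ p ^ 3 := by
      rw [pow_succ]; exact Ideal.mul_mem_mul m2 m1
    have h7 : x * (x * (x + a)) ∈ p ^ 3 := by
      have : x * (x * (x + a)) = (2 * x) * (- b) + (2 * 2) * (- c) := by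
        push_cast at hrel
        linear_combination hrel
      rw [this]
      exact Ideal.add_mem _ (Ideal.mul_mem_right _ _ h4) (Ideal.mul_mem_right _ _ h6)
    have h8 := c1 _ (cancel p hp0 hx hx2 h7)
    have := ev a (by simpa using p.sub_mem h8 hx)
    omega
  rw [hd] at hdisc
  exact arith_partial a b c i _ hi (by omega) (by omega) hdisc

lemma trichotomy (k : Type*) [Field k] [NumberField k] (h3 : Module.finrank ℚ k = 3)
    (hd : (2 : ℤ) ∣ NumberField.discr k) :
    ∃ P J : Ideal (𝓞 k), P.IsPrime ∧ J.IsPrime ∧ Ideal.span {(2 : 𝓞 k)} = P ^ 2 * J := by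
  have h := (not_iff_not.2 (NumberField.not_dvd_discr_iff_forall_liesOver k (𝓞 k)
    Int.prime_two)).1 (not_not.2 hd)
  push Not at h
  obtain ⟨P, hP, hPo, hun⟩ := h
  have hdv := dvd_differentIdeal_iff.2 hun
  have hmap : Ideal.map (algebraMap ℤ (𝓞 k)) (Ideal.span {2}) = Ideal.span {(2 : 𝓞 k)} := by
    simp [Ideal.map_span]
  have h2P : (2 : 𝓞 k) ∈ P := by
    have : (2 : ℤ) ∈ P.under ℤ := by
      rw [← hPo.over]; exact Ideal.mem_span_singleton_self _
    simpa [Ideal.mem_comap] using this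
  have hsq : P ^ 2 ∣ Ideal.span {(2 : 𝓞 k)} := by
    obtain ⟨Q, hQ⟩ := Ideal.dvd_span_singleton.2 h2P
    by_cases hPQ : P ∣ Q
    · rw [hQ, pow_two]; exact mul_dvd_mul_left _ hPQ
    exfalso
    have : (Ideal.span {(2 : ℤ)}).IsMaximal :=
      Ideal.IsPrime.isMaximal ((Ideal.span_singleton_prime two_ne_zero).2 Int.prime_two) (by simp)
    have : Finite (ℤ ⧸ Ideal.span {(2 : ℤ)}) := Ideal.finiteQuotientOfFreeOfNeBot _ (by simp)
    refine not_dvd_differentIdeal_of_isCoprime (A := ℤ) (p := Ideal.span {2}) P Q ?_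
      (by rw [hmap, hQ]) hdv
    rw [Ideal.isCoprime_iff_sup_eq]
    exact hP.out.2 _ (left_lt_sup.2 fun hle => hPQ (Ideal.dvd_iff_le.2 hle))
  obtain ⟨J, hJ⟩ := hsq
  refine ⟨P, J, hP.isPrime, ?_, hJ⟩
  have hn := congrArg Ideal.absNorm hJ
  have h8 : Ideal.absNorm (Ideal.span {(2 : 𝓞 k)}) = 8 := by
    rw [Ideal.absNorm_span_singleton]
    have := Algebra.norm_algebraMap (S := 𝓞 k) (2 : ℤ)
    rw [RingOfIntegers.rank, h3] at this
    simp at this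
    rw [this]; rfl
  rw [h8, map_mul, map_pow] at hn
  have hP1 : Ideal.absNorm P ≠ 1 := fun h => hP.ne_top (Ideal.absNorm_eq_one_iff.1 h)
  have hJ2 : Ideal.absNorm J = 2 := by
    generalize Ideal.absNorm P = s at *
    generalize Ideal.absNorm J = t at *
    have : s ≤ 2 := by
      by_contra hs
      have : t ≠ 0 := by rintro rfl; simp at hn
      have : 1 ≤ t := by omega
      nlinarith
    interval_cases s <;> omega
  exact Ideal.isPrime_of_irreducible_absNorm (by rw [hJ2]; exact Nat.prime_two)

end Cubic2

theorem statement8 (k : Type*) [Field k] [NumberField k]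
    (h3 : Module.finrank ℚ k = 3) :
    ((∃ p : Ideal (𝓞 k), p.IsPrime ∧ Ideal.span {(2 : 𝓞 k)} = p ^ 3) ↔
        NumberField.discr k % 32 = 20) ∧
    ((∃ p1 p2 : Ideal (𝓞 k), p1.IsPrime ∧ p2.IsPrime ∧ p1 ≠ p2 ∧
        Ideal.span {(2 : 𝓞 k)} = p1 ^ 2 * p2) ↔
        (NumberField.discr k % 16 = 8 ∨ NumberField.discr k % 16 = 12)) ∧
    padicValInt 2 (NumberField.discr k) ≤ 3 ∧
    NumberField.discr k % 32 ≠ 4 := by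
  let B : Module.Basis (Fin 3) ℤ (𝓞 k) := Module.finBasisOfFinrankEq ℤ (𝓞 k)
    (by rw [RingOfIntegers.rank, h3])
  have hB : Algebra.discr ℤ B = NumberField.discr k := NumberField.discr_eq_discr k B
  have hT : (∃ p : Ideal (𝓞 k), p.IsPrime ∧ Ideal.span {(2 : 𝓞 k)} = p ^ 3) →
      NumberField.discr k % 32 = 20 := by
    rintro ⟨p, hp, h⟩
    rw [← hB]; exact Cubic2.total B p h
  have hP : (∃ p1 p2 : Ideal (𝓞 k), p1.IsPrime ∧ p2.IsPrime ∧ p1 ≠ p2 ∧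
        Ideal.span {(2 : 𝓞 k)} = p1 ^ 2 * p2) →
        (NumberField.discr k % 16 = 8 ∨ NumberField.discr k % 16 = 12) := by
    rintro ⟨p, q, hp, hq, hpq, h⟩
    rw [← hB]; exact Cubic2.partially B p q hpq h
  have hU : 2 ∣ NumberField.discr k →
      (∃ p : Ideal (𝓞 k), p.IsPrime ∧ Ideal.span {(2 : 𝓞 k)} = p ^ 3) ∨
      (∃ p1 p2 : Ideal (𝓞 k), p1.IsPrime ∧ p2.IsPrime ∧ p1 ≠ p2 ∧
        Ideal.span {(2 : 𝓞 k)} = p1 ^ 2 * p2) := by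
    intro hd
    obtain ⟨P, J, hP, hJ, h⟩ := Cubic2.trichotomy k h3 hd
    by_cases e : P = J
    · subst e; exact Or.inl ⟨P, hP, by rw [h, pow_succ P 2]⟩
    · exact Or.inr ⟨P, J, hP, hJ, e, h⟩
  have hD : NumberField.discr k % 2 = 1 ∨ NumberField.discr k % 32 = 20 ∨
      NumberField.discr k % 16 = 8 ∨ NumberField.discr k % 16 = 12 := by
    by_cases hd : 2 ∣ NumberField.discr k
    · exact Or.inr ((hU hd).imp hT hP)
    · left; omega
  refine ⟨⟨hT, fun h => ?_⟩, ⟨hP, fun h => ?_⟩, ?_, ?_⟩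
  · rcases hU (by omega) with h' | h'
    · exact h'
    · have := hP h'; omega
  · rcases hU (by omega) with h' | h'
    · have := hT h'; omega
    · exact h'
  · by_contra hv
    have := (padicValInt_dvd_iff (p := 2) 4 (NumberField.discr k)).2 (Or.inr (by omega))
    norm_num at this
    omega
  · omega
end

section
/- Let k be a cyclic cubic field, i.e., a Galois extension of QQ of degree 3. Then the 2-rank of the ideal class group Cl(k) is even; equivalently, the 2-torsion subgroup Cl(k)[2] is isomorphic to (ZZ/2ZZ)^(2m) for some nonnegative integer m, so its cardinality is a perfect square. -/
open NumberField

/-- The `2`-torsion subgroup `G[2]` of a commutative group `G`. -/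
def twoTorsion (G : Type*) [CommGroup G] : Subgroup G where
  carrier := {x | x ^ 2 = 1}
  one_mem' := one_pow 2
  mul_mem' := by
    intro a b ha hb
    simp only [Set.mem_setOf_eq, mul_pow] at *
    rw [ha, hb, one_mul]
  inv_mem' := by
    intro a ha
    simp only [Set.mem_setOf_eq, inv_pow] at *
    rw [ha, inv_one]

open scoped Pointwise nonZeroDivisors

/-- The cube of the Galois norm of an ideal is principal. -/
theorem normIdeal_cube_principal (k : Type*) [Field k] [NumberField k] [IsGalois ℚ k]
    (h3 : Module.finrank ℚ k = 3) (I : Ideal (𝓞 k)) :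
    ((∏ g : Gal(k/ℚ), g • I) ^ 3).IsPrincipal := by
  have hG : Nat.card Gal(k/ℚ) = 3 := by rw [IsGalois.card_aut_eq_finrank, h3]
  have hGf : Fintype.card Gal(k/ℚ) = 3 := by rw [← Nat.card_eq_fintype_card, hG]
  have hmul : ∀ I J : Ideal (𝓞 k), I.IsPrincipal → J.IsPrincipal → (I * J).IsPrincipal := by
    rintro _ _ ⟨a, rfl⟩ ⟨b, rfl⟩
    exact ⟨a * b, by simp only [Ideal.submodule_span_eq, Ideal.span_singleton_mul_span_singleton]⟩
  have hpow : ∀ (I : Ideal (𝓞 k)) (n : ℕ), I.IsPrincipal → (I ^ n).IsPrincipal := by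
    rintro _ n ⟨a, rfl⟩
    exact ⟨a ^ n, by simp only [Ideal.submodule_span_eq, Ideal.span_singleton_pow]⟩
  induction I using UniqueFactorizationMonoid.induction_on_prime with
  | h₁ =>
    have : (∏ g : Gal(k/ℚ), g • (0 : Ideal (𝓞 k))) = 0 := by
      simp [hGf]
    rw [this, zero_pow (by norm_num)]
    exact bot_isPrincipal
  | h₂ x hx =>
    rw [Ideal.isUnit_iff] at hx
    subst hx
    rw [← Ideal.one_eq_top]
    simp only [smul_one, Finset.prod_const_one, one_pow]
    rw [Ideal.one_eq_top]
    exact top_isPrincipal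
  | h₃ a P ha hP ih =>
    simp only [smul_mul', Finset.prod_mul_distrib, mul_pow]
    refine hmul _ _ ?_ ih
    have : P.IsPrime := Ideal.isPrime_of_prime hP
    have hP0 : P ≠ ⊥ := hP.ne_zero
    set p : Ideal ℤ := P.under ℤ with hp
    have hp0 : p ≠ ⊥ := by
      intro h
      exact hP0 (Ideal.eq_bot_of_comap_eq_bot h)
    have : P.LiesOver p := ⟨rfl⟩
    have : p.IsPrime := inferInstance
    have : p.IsMaximal := Ideal.IsPrime.isMaximal inferInstance hp0
    have hN : ∀ Q ∈ (p.primesOver (𝓞 k)).toFinset,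
        (∏ g : Gal(k/ℚ), g • Q) ^ Q.ramificationIdx ℤ =
          (∏ g : Gal(k/ℚ), g • P) ^ (p.ramificationIdxIn (𝓞 k)) := by
      intro Q hQ
      rw [Set.mem_toFinset] at hQ
      have : Q.IsPrime := hQ.1
      have : Q.LiesOver p := hQ.2
      rw [← Ideal.ramificationIdxIn_eq_ramificationIdx p Q Gal(k/ℚ)]
      obtain ⟨σ, rfl⟩ := Ideal.exists_smul_eq_of_isGaloisGroup p P Q Gal(k/ℚ)
      congr 1
      simp only [smul_smul]
      exact Fintype.prod_equiv (Equiv.mulRight σ) _ _ (fun _ => rfl)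
    have key := Ideal.map_algebraMap_eq_finsetProd_pow (R := 𝓞 k) (p := p) hp0
    have hinv : ∀ g : Gal(k/ℚ), g • (p.map (algebraMap ℤ (𝓞 k))) = p.map (algebraMap ℤ (𝓞 k)) := by
      intro g
      rw [Ideal.pointwise_smul_def, Ideal.map_map]
      congr 1
      exact Subsingleton.elim _ _
    have hprod : (∏ g : Gal(k/ℚ), g • (p.map (algebraMap ℤ (𝓞 k)))).IsPrincipal := by
      simp only [hinv, Finset.prod_const]
      apply hpow
      obtain ⟨a, ha⟩ := (IsPrincipalIdealRing.principal p).principal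
      rw [ha, Ideal.submodule_span_eq, Ideal.map_span, Set.image_singleton]
      exact ⟨_, rfl⟩
    rw [key] at hprod
    simp only [Finset.smul_prod', smul_pow'] at hprod
    rw [Finset.prod_comm] at hprod
    simp only [Finset.prod_pow] at hprod
    rw [Finset.prod_congr rfl hN, Finset.prod_const, ← pow_mul,
      ← Set.ncard_eq_toFinset_card'] at hprod
    have hid := Ideal.ncard_primesOver_mul_ramificationIdxIn_mul_inertiaDegIn p (𝓞 k) Gal(k/ℚ)
    rw [hG] at hid
    rw [← hid, ← mul_assoc, mul_comm (p.primesOver (𝓞 k)).ncard, pow_mul]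
    exact hpow _ _ hprod

/-- The Galois conjugate of a nonzero ideal. -/
noncomputable def conjIdeal {k : Type*} [Field k] [NumberField k] (g : Gal(k/ℚ)) (I : (Ideal (𝓞 k))⁰) : (Ideal (𝓞 k))⁰ :=
  ⟨g • (I : Ideal (𝓞 k)), mem_nonZeroDivisors_of_ne_zero (by
    intro h
    have h1 : (I : Ideal (𝓞 k)) = 0 := by
      have h2 := congrArg (fun J : Ideal (𝓞 k) => g⁻¹ • J) h
      simpa using h2
    exact nonZeroDivisors.coe_ne_zero I h1)⟩

/-- The Galois action on the class group. -/
noncomputable def actCl {k : Type*} [Field k] [NumberField k] (g : Gal(k/ℚ))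
    (x : ClassGroup (𝓞 k)) : ClassGroup (𝓞 k) :=
  ClassGroup.mk0 (conjIdeal g (ClassGroup.mk0_surjective x).choose)

theorem actCl_mk0 {k : Type*} [Field k] [NumberField k] (g : Gal(k/ℚ))
    (I : (Ideal (𝓞 k))⁰) : actCl g (ClassGroup.mk0 I) = ClassGroup.mk0 (conjIdeal g I) := by
  have h := (ClassGroup.mk0_surjective (ClassGroup.mk0 I)).choose_spec
  unfold actCl
  generalize (ClassGroup.mk0_surjective (ClassGroup.mk0 I)).choose = J at h ⊢
  rw [ClassGroup.mk0_eq_mk0_iff] at h ⊢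
  obtain ⟨x, y, hx, hy, hxy⟩ := h
  refine ⟨g • x, g • y, (smul_ne_zero_iff_ne g).mpr hx, (smul_ne_zero_iff_ne g).mpr hy, ?_⟩
  have h2 := congrArg (fun J : Ideal (𝓞 k) => g • J) hxy
  simpa [smul_mul', Ideal.smul_closure, conjIdeal] using h2

theorem actCl_mul {k : Type*} [Field k] [NumberField k] (g : Gal(k/ℚ))
    (x y : ClassGroup (𝓞 k)) : actCl g (x * y) = actCl g x * actCl g y := by
  obtain ⟨I, rfl⟩ := ClassGroup.mk0_surjective x
  obtain ⟨J, rfl⟩ := ClassGroup.mk0_surjective y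
  rw [← map_mul, actCl_mk0, actCl_mk0, actCl_mk0, ← map_mul]
  congr 1
  apply Subtype.ext
  simp [conjIdeal, smul_mul']

theorem actCl_one_left {k : Type*} [Field k] [NumberField k] (x : ClassGroup (𝓞 k)) :
    actCl (1 : Gal(k/ℚ)) x = x := by
  obtain ⟨I, rfl⟩ := ClassGroup.mk0_surjective x
  rw [actCl_mk0]
  congr 1
  apply Subtype.ext
  simp [conjIdeal]

theorem actCl_mul_left {k : Type*} [Field k] [NumberField k] (g h : Gal(k/ℚ))
    (x : ClassGroup (𝓞 k)) : actCl (g * h) x = actCl g (actCl h x) := by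
  obtain ⟨I, rfl⟩ := ClassGroup.mk0_surjective x
  rw [actCl_mk0, actCl_mk0, actCl_mk0]
  congr 1
  apply Subtype.ext
  simp [conjIdeal, mul_smul]

theorem actCl_one {k : Type*} [Field k] [NumberField k] (g : Gal(k/ℚ)) :
    actCl g (1 : ClassGroup (𝓞 k)) = 1 := by
  have h := actCl_mul g (1 : ClassGroup (𝓞 k)) 1
  rw [mul_one] at h
  exact (mul_eq_left.mp h.symm)

/-- The Galois action on the 2-torsion of the class group. -/
noncomputable instance actTwo (k : Type*) [Field k] [NumberField k] :
    MulAction Gal(k/ℚ) (twoTorsion (ClassGroup (𝓞 k))) where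
  smul g x := ⟨actCl g x.1, by
    have hx : x.1 ^ 2 = 1 := x.2
    change (actCl g x.1) ^ 2 = 1
    rw [pow_two, ← actCl_mul, ← pow_two, hx, actCl_one]⟩
  one_smul x := Subtype.ext (actCl_one_left x.1)
  mul_smul g h x := Subtype.ext (actCl_mul_left g h x.1)

theorem fixed_eq_one (k : Type*) [Field k] [NumberField k] [IsGalois ℚ k]
    (h3 : Module.finrank ℚ k = 3) (x : ClassGroup (𝓞 k)) (hx : x ^ 2 = 1)
    (hfix : ∀ g : Gal(k/ℚ), actCl g x = x) : x = 1 := by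
  have hG : Nat.card Gal(k/ℚ) = 3 := by rw [IsGalois.card_aut_eq_finrank, h3]
  have hGf : Fintype.card Gal(k/ℚ) = 3 := by rw [← Nat.card_eq_fintype_card, hG]
  obtain ⟨I, rfl⟩ := ClassGroup.mk0_surjective x
  have h1 : ClassGroup.mk0 ((∏ g : Gal(k/ℚ), conjIdeal g I) ^ 3) = ClassGroup.mk0 I ^ 9 := by
    rw [map_pow, map_prod]
    simp only [← actCl_mk0, hfix, Finset.prod_const, Finset.card_univ, hGf, ← pow_mul]
  have h2 : ClassGroup.mk0 ((∏ g : Gal(k/ℚ), conjIdeal g I) ^ 3) = 1 := by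
    rw [ClassGroup.mk0_eq_one_iff (SetLike.coe_mem _)]
    have := normIdeal_cube_principal k h3 (I : Ideal (𝓞 k))
    simpa [conjIdeal] using this
  rw [h2] at h1
  calc ClassGroup.mk0 I = ClassGroup.mk0 I ^ 9 * ((ClassGroup.mk0 I ^ 2) ^ 4)⁻¹ := by group
    _ = 1 := by rw [← h1, hx]; simp

/-- Let `k` be a cyclic cubic field, i.e. a Galois extension of `ℚ` of
degree `3`.  Then the `2`-rank of the class group `Cl(k)` is even: the `2`-torsion
subgroup `Cl(k)[2]` is isomorphic to `(ℤ/2ℤ)^(2m)` for some `m ≥ 0`; in particular its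
cardinality is a perfect square. -/
theorem statement9 (k : Type*) [Field k] [NumberField k] [IsGalois ℚ k]
    (h3 : Module.finrank ℚ k = 3) :
    (∃ m : ℕ, Nonempty ((twoTorsion (ClassGroup (𝓞 k))) ≃*
        Multiplicative (Fin (2 * m) → ZMod 2))) ∧
    IsSquare (Nat.card (twoTorsion (ClassGroup (𝓞 k)))) := by
  classical
  have hG : Nat.card Gal(k/ℚ) = 3 := by rw [IsGalois.card_aut_eq_finrank, h3]
  have : Fact (Nat.Prime 3) := ⟨Nat.prime_three⟩
  have hpg : IsPGroup 3 Gal(k/ℚ) := IsPGroup.of_card (n := 1) (by rw [hG, pow_one])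
  have : Finite (ClassGroup (𝓞 k)) := inferInstance
  have hfin : Finite (twoTorsion (ClassGroup (𝓞 k))) := inferInstance
  have hmod := hpg.card_modEq_card_fixedPoints (twoTorsion (ClassGroup (𝓞 k)))
  have hone : Nat.card (MulAction.fixedPoints Gal(k/ℚ) (twoTorsion (ClassGroup (𝓞 k)))) = 1 := by
    rw [Nat.card_eq_one_iff_unique]
    refine ⟨⟨?_⟩, ⟨⟨1, fun g => Subtype.ext (actCl_one g)⟩⟩⟩
    have hall : ∀ a : MulAction.fixedPoints Gal(k/ℚ) (twoTorsion (ClassGroup (𝓞 k))),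
        a.1.1 = 1 := fun a =>
      fixed_eq_one k h3 a.1.1 a.1.2 (fun g => congrArg Subtype.val (a.2 g))
    intro a b
    exact Subtype.ext (Subtype.ext ((hall a).trans (hall b).symm))
  rw [hone] at hmod
  let A := Additive (twoTorsion (ClassGroup (𝓞 k)))
  have : Finite A := hfin
  letI : Module (ZMod 2) A := AddCommGroup.zmodModule (n := 2) (by
    intro x
    exact Subtype.ext (x.toMul.2))
  let b := Module.finBasis (ZMod 2) A
  let e := b.equivFun
  have hcard : Nat.card (twoTorsion (ClassGroup (𝓞 k))) = 2 ^ Module.finrank (ZMod 2) A := by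
    have h := Nat.card_congr e.toEquiv
    have h' : Nat.card A = Nat.card (twoTorsion (ClassGroup (𝓞 k))) :=
      Nat.card_congr Additive.toMul
    rw [← h', h]
    simp
  have heven : Even (Module.finrank (ZMod 2) A) := by
    rw [hcard] at hmod
    by_contra hodd
    rw [Nat.not_even_iff_odd] at hodd
    obtain ⟨m, hm⟩ := hodd
    rw [hm, pow_succ, pow_mul] at hmod
    have h4 : (2 ^ 2) ^ m * 2 ≡ 1 ^ m * 2 [MOD 3] :=
      Nat.ModEq.mul_right _ (Nat.ModEq.pow _ rfl)
    have := h4.symm.trans hmod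
    rw [one_pow] at this
    exact absurd this (by decide)
  obtain ⟨m, hm⟩ := heven
  refine ⟨⟨m, ⟨?_⟩⟩, ⟨2 ^ m, by rw [hcard, hm, pow_add]⟩⟩
  have hm2 : Module.finrank (ZMod 2) A = 2 * m := by omega
  let e2 : A ≃+ (Fin (2 * m) → ZMod 2) :=
    (b.reindex (finCongr hm2)).equivFun.toAddEquiv
  exact AddEquiv.toMultiplicativeRight e2
end
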